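/- arXiv:1103.3939 — 2 statements merged into one kernel-verified Lean document; each statement's English description precedes it below -/
import Mathlib

section
/- Let m, n ≥ 5 be integers. If cd(S_m) ⊆ cd(S_n), then m = n. -/
open CategoryTheory

/-- The set of degrees of irreducible complex representations of `G`. -/
noncomputable def cd (G : Type) [Group G] : Set ℕ :=
  {d | ∃ V : FDRep ℂ G, Simple V ∧ Module.finrank ℂ V = d}

open Representation
open scoped MonoidAlgebra

theorem isIrreducible_of_simple {G : Type} [Group G] (V : FDRep ℂ G) [Simple V] :
    IsIrreducible V.ρ := by
  have hnt : Nontrivial V := by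
    by_contra hV
    rw [not_nontrivial_iff_subsingleton] at hV
    apply id_nonzero V
    apply (forget₂ (FDRep ℂ G) (Rep ℂ G)).map_injective
    ext v
    exact Subsingleton.elim (α := V) _ _
  have : Nontrivial (Subrepresentation V.ρ) := by
    obtain ⟨v, hv⟩ := exists_ne (0 : V)
    refine ⟨⊥, ⊤, fun h => hv ?_⟩
    have : v ∈ (⊤ : Subrepresentation V.ρ) := trivial
    rw [← h] at this
    exact this
  refine ⟨fun W => ?_⟩
  let f : FDRep.of W.toRepresentation ⟶ V :=
    (FDRep.forget₂HomLinearEquiv _ _) (Rep.ofHom ⟨W.toSubmodule.subtype, fun g => rfl⟩)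
  have hf : ∀ w : W.toSubmodule, f.hom.hom.hom w = w.1 := fun w => rfl
  have : Mono f := by
    constructor
    intro Z a b h
    have : ∀ z : Z, a.hom.hom.hom z = b.hom.hom.hom z := by
      intro z
      have := congr($(h).hom.hom.hom z)
      exact Subtype.ext this
    ext z
    exact congrArg Subtype.val (this z)
  by_cases h0 : f = 0
  · left
    apply le_antisymm _ bot_le
    intro w hw
    have := hf ⟨w, hw⟩
    rw [h0] at this
    exact this.symm
  · right
    have hi := isIso_of_mono_of_nonzero h0
    apply le_antisymm le_top
    intro v _
    have := congr($(IsIso.inv_hom_id f).hom.hom.hom v)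
    change _ = v at this
    rw [← this]
    exact ((inv f).hom.hom.hom v).2

theorem simple_of_isIrreducible {G : Type} [Group G] [Finite G] {V : Type} [AddCommGroup V]
    [Module ℂ V] [Module.Finite ℂ V] (ρ : Representation ℂ G V) [IsIrreducible ρ] :
    Simple (FDRep.of ρ) := by
  have : NeZero (Nat.card G : ℂ) := ⟨Nat.cast_ne_zero.2 Nat.card_pos.ne'⟩
  rw [FDRep.simple_iff_end_is_rank_one]
  rw [← IsIrreducible.finrank_intertwiningMap_self (ρ := ρ)]
  exact ((FDRep.forget₂HomLinearEquiv (FDRep.of ρ) (FDRep.of ρ)).symm.trans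
    (Rep.homLinearEquiv _ _)).finrank_eq

theorem mem_cd_iff {G : Type} [Group G] [Finite G] {d : ℕ} :
    d ∈ cd G ↔ ∃ (V : Type) (_ : AddCommGroup V) (_ : Module ℂ V) (_ : Module.Finite ℂ V)
      (ρ : Representation ℂ G V), IsIrreducible ρ ∧ Module.finrank ℂ V = d := by
  constructor
  · rintro ⟨V, hV, rfl⟩
    exact ⟨V, inferInstance, inferInstance, inferInstance, V.ρ, isIrreducible_of_simple V, rfl⟩
  · rintro ⟨V, _, _, _, ρ, hρ, rfl⟩
    exact ⟨FDRep.of ρ, simple_of_isIrreducible ρ, rfl⟩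

theorem exists_smul_eq_self_and_smul_eq_zero {A S : Type} [Ring A] [IsSemisimpleRing A]
    [AddCommGroup S] [Module A S] [IsSimpleModule A S] :
    ∃ e : A, (∀ s : S, e • s = s) ∧ ∀ (M : Type) [AddCommGroup M] [Module A M],
      (∀ m : M, e • m = 0) ∨ ∃ f : S →ₗ[A] M, f ≠ 0 := by
  obtain ⟨J, ⟨j⟩⟩ := IsSemisimpleRing.exists_linearEquiv_ideal_of_isSimpleModule A S
  have hJle : J ≤ isotypicComponent A A S := le_sSup ⟨j.symm⟩
  let I : fullyInvariantSubmodule A A :=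
    ⟨isotypicComponent A A S, Submodule.IsFullyInvariant.isotypicComponent (R := A) (M := A) (S := S)⟩
  have : ComplementedLattice (fullyInvariantSubmodule A A) :=
    (OrderIso.setIsotypicComponents (R := A) (M := A)).complementedLattice
  obtain ⟨K, hIK⟩ := exists_isCompl I
  have hc : IsCompl I.1 K.1 := CompleteSublattice.isCompl_iff.mp hIK
  obtain ⟨e, he, f, hf, hef⟩ := Submodule.mem_sup.mp
    (hc.sup_eq_top ▸ Submodule.mem_top : (1 : A) ∈ I.1 ⊔ K.1)
  refine ⟨e, fun s => ?_, fun M _ _ => ?_⟩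
  · have key : ∀ x ∈ I.1, e * x = x := by
      intro x hx
      have h1 : f * x ∈ K.1 := K.2 (LinearMap.toSpanSingleton A A x) hf
      have h2 : f * x ∈ I.1 := I.1.smul_mem f hx
      have h3 : f * x = 0 := by
        have := hc.disjoint.le_bot ⟨h2, h1⟩
        simpa using this
      calc e * x = (e + f) * x := by rw [add_mul, h3, add_zero]
        _ = x := by rw [hef, one_mul]
    apply j.injective
    rw [map_smul]
    exact Subtype.ext (key _ (hJle (j s).2))
  · by_cases h : ∃ f : S →ₗ[A] M, f ≠ 0
    · exact Or.inr h
    · left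
      push Not at h
      intro m
      have : isotypicComponent A A S ≤ LinearMap.ker (LinearMap.toSpanSingleton A M m) := by
        refine sSup_le ?_
        rintro N ⟨n⟩ x hx
        have := h ((LinearMap.toSpanSingleton A M m) ∘ₗ N.subtype ∘ₗ n.symm.toLinearMap)
        have := congr($this (n ⟨x, hx⟩))
        simpa using this
      exact this he

theorem exists_asAlgebraHom_eq_one {H V : Type} [Group H] [Finite H] [AddCommGroup V] [Module ℂ V]
    (ρ : Representation ℂ H V) [IsIrreducible ρ] :
    ∃ e : ℂ[H], asAlgebraHom ρ e = 1 ∧ ∀ (W : Type) [AddCommGroup W] [Module ℂ W]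
      (σ : Representation ℂ H W), asAlgebraHom σ e = 0 ∨
        ∃ f : IntertwiningMap ρ σ, Function.Injective f := by
  have : NeZero (Nat.card H : ℂ) := ⟨Nat.cast_ne_zero.2 Nat.card_pos.ne'⟩
  obtain ⟨e, h1, h2⟩ := exists_smul_eq_self_and_smul_eq_zero (A := ℂ[H]) (S := ρ.asModule)
  refine ⟨e, LinearMap.ext h1, fun W _ _ σ => ?_⟩
  refine (h2 σ.asModule).imp (fun h => LinearMap.ext h) fun ⟨f, hf⟩ => ?_
  refine ⟨(IntertwiningMap.equivLinearMapAsModule ρ σ).symm f, ?_⟩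
  refine (IsIrreducible.injective_or_eq_zero _).resolve_right ?_
  simpa using hf

theorem finite_monoidAlgebra (G : Type) [Finite G] : Module.Finite ℂ ℂ[G] :=
  Module.Finite.equiv (MonoidAlgebra.coeffLinearEquiv ℂ).symm

theorem smul_eq_zero_of_asAlgebraHom_eq_zero {G : Type} [Group G] [Finite G] {x : ℂ[G]}
    (hx : ∀ (W : Type) [AddCommGroup W] [Module ℂ W] [Module.Finite ℂ W]
      (σ : Representation ℂ G W), IsIrreducible σ → asAlgebraHom σ x = 0)
    (M : Type) [AddCommGroup M] [Module ℂ[G] M] [IsSimpleModule ℂ[G] M] (m : M) : x • m = 0 := by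
  have hirr := (isSimpleModule_iff_irreducible_ofModule (k := ℂ) (G := G) M).1 inferInstance
  have := finite_monoidAlgebra G
  have : Module.Finite ℂ (RestrictScalars ℂ ℂ[G] M) := by
    let _ : Module ℂ[G] (RestrictScalars ℂ ℂ[G] M) := RestrictScalars.moduleOrig ..
    have : Module.Finite ℂ[G] (RestrictScalars ℂ ℂ[G] M) :=
      inferInstanceAs (Module.Finite ℂ[G] M)
    exact Module.Finite.trans ℂ[G] _
  have hz : (ofModule M).asAlgebraHom x = 0 :=
    @hx (RestrictScalars ℂ ℂ[G] M) _ (RestrictScalars.module ℂ ℂ[G] M) this (ofModule M) hirr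
  have h1 := ofModule_asAlgebraHom_apply_apply (k := ℂ) (G := G) M x
    ((RestrictScalars.addEquiv ℂ ℂ[G] M).symm m)
  rw [hz] at h1
  simpa using h1.symm

theorem eq_zero_of_asAlgebraHom_eq_zero {G : Type} [Group G] [Finite G] {x : ℂ[G]}
    (hx : ∀ (W : Type) [AddCommGroup W] [Module ℂ W] [Module.Finite ℂ W]
      (σ : Representation ℂ G W), IsIrreducible σ → asAlgebraHom σ x = 0) : x = 0 := by
  have : NeZero (Nat.card G : ℂ) := ⟨Nat.cast_ne_zero.2 Nat.card_pos.ne'⟩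
  have hb : Ring.jacobson ℂ[G] = ⊥ := IsSemisimpleModule.jacobson_eq_bot _ _
  rw [← Ideal.mem_bot, ← hb, Ring.jacobson_eq_sInf_isMaximal, Ideal.mem_sInf]
  intro m hm
  let M := HasQuotient.Quotient (A := ℂ[G]) (B := Submodule ℂ[G] ℂ[G]) m
  have hs : IsSimpleModule ℂ[G] M := isSimpleModule_iff_isCoatom.2 (Ideal.isMaximal_def.1 hm)
  have h0 := smul_eq_zero_of_asAlgebraHom_eq_zero hx M (Submodule.Quotient.mk 1)
  rwa [← Submodule.Quotient.mk_smul, Submodule.Quotient.mk_eq_zero, smul_eq_mul, mul_one] at h0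

theorem finrank_le_natCard {G V : Type} [Group G] [Finite G] [AddCommGroup V] [Module ℂ V]
    (ρ : Representation ℂ G V) [IsIrreducible ρ] : Module.finrank ℂ V ≤ Nat.card G := by
  have := finite_monoidAlgebra G
  have hnt : Nontrivial ρ.asModule := IsSimpleModule.nontrivial ℂ[G] _
  obtain ⟨v, hv⟩ := exists_ne (0 : ρ.asModule)
  have hsurj := IsSimpleModule.toSpanSingleton_surjective ℂ[G] hv
  have h1 := LinearMap.finrank_le_finrank_of_surjective
    (f := (LinearMap.toSpanSingleton ℂ[G] ρ.asModule v).restrictScalars ℂ) hsurj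
  have h2 : Module.finrank ℂ ℂ[G] = Nat.card G := by
    have := Fintype.ofFinite G
    rw [(MonoidAlgebra.coeffLinearEquiv ℂ : ℂ[G] ≃ₗ[ℂ] _).finrank_eq, Module.finrank_finsupp_self,
      Nat.card_eq_fintype_card]
  exact h1.trans_eq h2

theorem not_cd_subset {G H : Type} [Group G] [Group H] [Finite G] [Finite H] (ι : H →* G)
    (hι : Function.Injective ι)
    (hcore : ∀ h : H, (∀ g : G, g * ι h * g⁻¹ ∈ ι.range) → h = 1)
    (χ : H →* ℂˣ) (hχ : χ ≠ 1) (d : ℕ)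
    (hd : ∀ (V : Type) [AddCommGroup V] [Module ℂ V] [Module.Finite ℂ V]
      (σ : Representation ℂ G V), IsIrreducible σ → Module.finrank ℂ V ≤ d)
    (V : Type) [AddCommGroup V] [Module ℂ V] [Module.Finite ℂ V] (ρ : Representation ℂ H V)
    [IsIrreducible ρ] : Module.finrank ℂ V ≠ d := by
  rintro rfl
  obtain ⟨e, he1, he⟩ := exists_asAlgebraHom_eq_one ρ
  have hcomm : ∀ g : G, MonoidAlgebra.single g 1 * MonoidAlgebra.mapDomain ι e
      = MonoidAlgebra.mapDomain ι e * MonoidAlgebra.single g (1 : ℂ) := by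
    intro g
    rw [← sub_eq_zero]
    apply eq_zero_of_asAlgebraHom_eq_zero
    intro W _ _ _ σ hσ
    have hres : asAlgebraHom σ (MonoidAlgebra.mapDomain ι e) = asAlgebraHom (σ.comp ι) e := by
      clear he1 he
      induction e using MonoidAlgebra.induction_linear with
      | zero => simp
      | add x y hx hy => simp [MonoidAlgebra.mapDomain_add, hx, hy]
      | single g a => simp
    rcases he W (σ.comp ι) with h | ⟨f, hf⟩
    · simp [hres, h]
    · have hfs : Function.Surjective f.toLinearMap :=
        (LinearMap.injective_iff_surjective_of_finrank_eq_finrank (f := f.toLinearMap)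
          (le_antisymm (LinearMap.finrank_le_finrank_of_injective (f := f.toLinearMap) hf)
            (hd W σ hσ))).1 hf
      have : asAlgebraHom (σ.comp ι) e = 1 := by
        ext w
        obtain ⟨v, rfl⟩ := hfs w
        have := (IntertwiningMap.equivLinearMapAsModule ρ (σ.comp ι) f).map_smul e v
        exact this.symm.trans (congrArg f (LinearMap.congr_fun he1 v))
      simp [hres, this]
  have hsupp : ∀ h : H, h ≠ 1 → e.coeff h = 0 := by
    intro h hh
    by_contra hne
    refine hh (hcore h fun g => ?_)
    have h1 := congr(($(hcomm g)).coeff (g * ι h))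
    by_contra hr
    rw [MonoidAlgebra.coeff_single_mul_apply, MonoidAlgebra.coeff_mul_single_apply,
      one_mul, mul_one, inv_mul_cancel_left, MonoidAlgebra.coeff_mapDomain,
      Finsupp.mapDomain_apply hι, Finsupp.mapDomain_of_notMem_range] at h1
    · exact hne h1
    · exact hr
  have heq : e = MonoidAlgebra.single 1 (e.coeff 1) := by
    ext h
    by_cases hh : h = 1
    · simp [hh]
    · simp [hsupp h hh, Ne.symm hh]
  have hnt : Nontrivial V := IsSimpleModule.nontrivial ℂ[H] ρ.asModule
  have hc : e.coeff 1 = 1 := by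
    obtain ⟨v, hv⟩ := exists_ne (0 : V)
    have := LinearMap.congr_fun he1 v
    rw [heq] at this
    have h3 : (e.coeff 1 - 1) • v = 0 := by
      rw [sub_smul, one_smul, sub_eq_zero]
      simpa using this
    exact sub_eq_zero.1 ((smul_eq_zero.1 h3).resolve_right hv)
  have hembed : ∀ (σ : Representation ℂ H ℂ), ∃ f : IntertwiningMap ρ σ, Function.Injective f := by
    intro σ
    refine (he ℂ σ).resolve_left fun h0 => ?_
    rw [heq, hc] at h0
    have := LinearMap.congr_fun h0 1
    simp at this
  obtain ⟨f₁, hf₁⟩ := hembed 1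
  obtain ⟨f₂, hf₂⟩ := hembed ((Units.coeHom _).comp
    ((Units.map (Algebra.lmul ℂ ℂ).toMonoidHom).comp χ))
  obtain ⟨v, hv⟩ := exists_ne (0 : V)
  refine hχ (MonoidHom.ext fun h => Units.ext ?_)
  have h1 : ρ h v = v := hf₁ (by simpa using IntertwiningMap.isIntertwining _ _ f₁ h v)
  have h2 := IntertwiningMap.isIntertwining _ _ f₂ h v
  have h3 : (χ h : ℂ) * f₂ v = f₂ v := by
    simpa [h1] using h2.symm
  have h4 : f₂ v ≠ 0 := fun h0 => hv (hf₂ (h0.trans (map_zero f₂.toLinearMap).symm))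
  exact mul_right_cancel₀ h4 (h3.trans (one_mul _).symm)

section
open Equiv Equiv.Perm

theorem four_le_finrank_of_pow_five_eq_one {V : Type} [AddCommGroup V] [Module ℂ V]
    [Module.Finite ℂ V] {A B C : Module.End ℂ V} (hA : A ^ 5 = 1) (hCB : C * B = 1)
    (hB : B * A = A ^ 2 * B) (h1 : A ≠ 1) : 4 ≤ Module.finrank ℂ V := by
  let R : Submodule ℂ V := LinearMap.range (A - 1)
  have hR : ∀ w ∈ R, A w ∈ R := by
    rintro _ ⟨v, rfl⟩
    exact ⟨A v, by simp⟩
  have hnt : Nontrivial R := by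
    rw [Submodule.nontrivial_iff_ne_bot, Ne, LinearMap.range_eq_bot, sub_eq_zero]
    exact h1
  obtain ⟨ζ, hζ⟩ := Module.End.exists_eigenvalue (A.restrict hR)
  obtain ⟨w, hw⟩ := hζ.exists_hasEigenvector
  have hw0 : (w : V) ≠ 0 := fun h => hw.2 (Subtype.ext h)
  have hAw : A w = ζ • (w : V) := congrArg Subtype.val hw.apply_eq_smul
  obtain ⟨v, hv⟩ := w.2
  generalize (w : V) = u at *
  have hpow : ∀ n : ℕ, ∀ (μ : ℂ) (x : V), A x = μ • x → (A ^ n) x = μ ^ n • x := by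
    intro n μ x hx
    induction n with
    | zero => simp
    | succ n ih => rw [pow_succ', Module.End.mul_apply, ih, map_smul, hx, smul_smul, pow_succ]
  have hS : (A ^ 4) u + (A ^ 3) u + (A ^ 2) u + A u + u = 0 := by
    have : (A ^ 4 + A ^ 3 + A ^ 2 + A + 1) * (A - 1) = 0 := by
      calc _ = A ^ 5 - 1 := by noncomm_ring
        _ = 0 := by rw [hA, sub_self]
    rw [← hv]
    exact LinearMap.congr_fun this v
  have hζ1 : ζ ≠ 1 := by
    rintro rfl
    rw [hpow 4 _ _ hAw, hpow 3 _ _ hAw, hpow 2 _ _ hAw, hAw] at hS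
    simp only [one_pow, one_smul, ← two_smul ℂ u] at hS
    have : (5 : ℂ) • u = 0 := by rw [← hS]; module
    simp [hw0] at this
  have hζ5 : ζ ^ 5 = 1 := by
    have h5 := hpow 5 _ _ hAw
    rw [hA, Module.End.one_apply] at h5
    have : (ζ ^ 5 - 1) • u = 0 := by rw [sub_smul, ← h5, one_smul, sub_self]
    exact sub_eq_zero.1 ((smul_eq_zero.1 this).resolve_right hw0)
  have hprim : IsPrimitiveRoot ζ 5 := by
    have : Fact (Nat.Prime 5) := ⟨Nat.prime_five⟩
    exact IsPrimitiveRoot.iff_orderOf.2 (orderOf_eq_prime hζ5 hζ1)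
  have hBinj : ∀ x, x ≠ 0 → B x ≠ 0 := by
    intro x hx h
    have := LinearMap.congr_fun hCB x
    rw [Module.End.mul_apply, h, map_zero] at this
    exact hx this.symm
  have hstep : ∀ (μ : ℂ) (x : V), A x = μ • x → A (B x) = μ ^ 3 • B x := by
    intro μ x hx
    have h2 : A * B = B * A ^ 3 := by
      have e1 : A * B = A ^ 5 * (A * B) := by rw [hA, one_mul]
      have e2 : ∀ n, A ^ (2 * n) * B = B * A ^ n := by
        intro n
        induction n with
        | zero => simp
        | succ n ih => rw [pow_succ, ← mul_assoc, ← ih, mul_assoc, hB, ← mul_assoc, ← pow_add]; rfl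
      rw [← e2 3, e1, ← mul_assoc, ← pow_succ]
    rw [← Module.End.mul_apply, h2, Module.End.mul_apply, hpow 3 _ _ hx, map_smul]
  have e1 := hstep _ _ hAw
  have e2 := hstep _ _ e1
  have e3 := hstep _ _ e2
  have n1 := hBinj _ hw0
  have n2 := hBinj _ n1
  have n3 := hBinj _ n2
  have hμ : Function.Injective ![ζ ^ 1, ζ ^ 3, ζ ^ 4, ζ ^ 2] := by
    have : ![ζ ^ 1, ζ ^ 3, ζ ^ 4, ζ ^ 2] = (fun i => ζ ^ (![1, 3, 4, 2] : Fin 4 → ℕ) i) := by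
      ext i; fin_cases i <;> rfl
    rw [this]
    intro i j hij
    have := hprim.pow_inj (by fin_cases i <;> simp) (by fin_cases j <;> simp) hij
    revert this
    fin_cases i <;> fin_cases j <;> simp
  have hli := Module.End.eigenvectors_linearIndependent' A _ hμ ![u, B u, B (B u), B (B (B u))] (by
    intro i
    rw [Module.End.hasEigenvector_iff, Module.End.mem_eigenspace_iff]
    fin_cases i
    · exact ⟨by simpa using hAw, hw0⟩
    · exact ⟨e1, n1⟩
    · refine ⟨e2.trans ?_, n2⟩
      congr 1
      simp only [Fin.reduceFinMk, Matrix.cons_val]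
      linear_combination ζ ^ 4 * hζ5
    · refine ⟨e3.trans ?_, n3⟩
      congr 1
      simp only [Fin.reduceFinMk, Matrix.cons_val]
      linear_combination (ζ ^ 22 + ζ ^ 17 + ζ ^ 12 + ζ ^ 7 + ζ ^ 2) * hζ5)
  simpa using hli.fintype_card_le_finrank

theorem isThreeCycle_eq_one_of_exists {α M : Type*} [Fintype α] [DecidableEq α] [Monoid M]
    (ρ : Perm α →* M) {g : Perm α} (hg : g.IsThreeCycle) (h : ρ g = 1) {g' : Perm α}
    (hg' : g'.IsThreeCycle) : ρ g' = 1 := by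
  obtain ⟨c, hc⟩ := isConj_iff.1 (isConj_iff_cycleType_eq.2 (hg.trans hg'.symm))
  rw [← hc, map_mul, map_mul, h, mul_one, ← map_mul, mul_inv_cancel, map_one]

/-- Every complex representation of a symmetric group on `k` letters in which some three-cycle
acts nontrivially has dimension at least `k - 1`. -/
def FinrankBound (k : ℕ) : Prop :=
  ∀ (α : Type) [Fintype α] [DecidableEq α] (V : Type) [AddCommGroup V] [Module ℂ V]
    [Module.Finite ℂ V] (ρ : Representation ℂ (Perm α) V), Fintype.card α = k →
    Module.finrank ℂ V + 1 < k → ∀ g : Perm α, g.IsThreeCycle → ρ g = 1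

theorem finrankBound_five : FinrankBound 5 := by
  intro α _ _ V _ _ _ ρ hα hV g hg
  let e : Fin 5 ≃ α := (Fintype.equivFinOfCardEq hα).symm
  let σ : Representation ℂ (Perm (Fin 5)) V := ρ.comp e.permCongrHom.toMonoidHom
  have hrot : σ (finRotate 5) = 1 := by
    by_contra h1
    let b : Perm (Fin 5) := swap 1 2 * swap 2 4 * swap 4 3
    have := four_le_finrank_of_pow_five_eq_one (A := σ (finRotate 5)) (B := σ b) (C := σ b⁻¹)
      (by rw [← map_pow, show finRotate 5 ^ 5 = 1 by decide, map_one])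
      (by rw [← map_mul, inv_mul_cancel, map_one])
      (by rw [← map_mul, ← map_pow, ← map_mul]; congr 1; decide) h1
    omega
  have h3 : σ (swap 1 2 * swap 1 0) = 1 := by
    rw [show (swap 1 2 * swap 1 0 : Perm (Fin 5)) =
      finRotate 5 * (swap 0 1 * (finRotate 5)⁻¹ * swap 0 1) by decide]
    have hinv : σ (finRotate 5)⁻¹ = 1 := by
      have : σ ((finRotate 5)⁻¹ * finRotate 5) = 1 := by rw [inv_mul_cancel, map_one]
      rwa [map_mul, hrot, mul_one] at this
    rw [map_mul, map_mul, map_mul, hrot, hinv, one_mul, mul_one, ← map_mul, swap_mul_self, map_one]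
  refine isThreeCycle_eq_one_of_exists ρ (g := e.permCongrHom (swap 1 2 * swap 1 0)) ?_ h3 hg
  have hs : ∀ i j, e.permCongrHom (swap i j) = swap (e i) (e j) := by
    intro i j
    exact Equiv.symm_trans_swap_trans i j e
  rw [map_mul, hs, hs]
  exact isThreeCycle_swap_mul_swap_same (by simp) (by simp) (by simp)

theorem FinrankBound.isThreeCycle_eq_one {k : ℕ} (hk : FinrankBound k) (hk3 : 3 ≤ k) {α : Type}
    [Fintype α] [DecidableEq α] (p : α → Prop) [DecidablePred p]
    (hp : Fintype.card {x // p x} = k) {V : Type} [AddCommGroup V] [Module ℂ V]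
    [Module.Finite ℂ V] (ρ : Representation ℂ (Perm α) V) (f : Module.End ℂ V)
    (hf : ∀ h : Perm {x // p x}, Commute (ρ (ofSubtype h)) f)
    (hker : Module.finrank ℂ (LinearMap.ker f) + 1 < k)
    (hrange : Module.finrank ℂ (LinearMap.range f) + 1 < k)
    {g : Perm α} (hg : g.IsThreeCycle) : ρ g = 1 := by
  let σ : Representation ℂ (Perm {x // p x}) V := ρ.comp ofSubtype
  have hfv : ∀ h v, f (σ h v) = σ h (f v) := fun h v => (LinearMap.congr_fun (hf h) v).symm
  let K : Subrepresentation σ := ⟨LinearMap.ker f, fun h v (hv : f v = 0) => by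
    change f _ = 0
    rw [hfv, hv, map_zero]⟩
  let R : Subrepresentation σ := ⟨LinearMap.range f, fun h v => by
    rintro ⟨u, rfl⟩
    exact ⟨σ h u, hfv h u⟩⟩
  obtain ⟨a, b, c, hab, hac, hbc⟩ := Fintype.two_lt_card_iff.1 (hp.symm ▸ hk3)
  have hs := isThreeCycle_swap_mul_swap_same hab hac hbc
  set s := swap a b * swap a c
  refine isThreeCycle_eq_one_of_exists ρ (g := ofSubtype s) (cycleType_ofSubtype.trans hs) ?_ hg
  have hK : ∀ v, f v = 0 → σ s v = v := fun v hv =>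
    congrArg Subtype.val (LinearMap.congr_fun (hk _ _ K.toRepresentation hp hker s hs) ⟨v, hv⟩)
  have hR : ∀ v, σ s (f v) = f v := fun v =>
    congrArg Subtype.val
      (LinearMap.congr_fun (hk _ _ R.toRepresentation hp hrange s hs) ⟨f v, ⟨v, rfl⟩⟩)
  set N : Module.End ℂ V := σ s - 1 with hN
  have hNN : N * N = 0 := by
    ext v
    have : f (N v) = 0 := by simp [hN, hfv, hR]
    change σ s (N v) - N v = 0
    rw [hK _ this, sub_self]
  have hs3 : σ s ^ 3 = 1 := by rw [← map_pow, ← hs.orderOf, pow_orderOf_eq_one, map_one]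
  have hσ : σ s = N + 1 := by simp [hN]
  have h3 : (3 : ℂ) • N = 0 := by
    have : (N + 1) ^ 3 - 1 = N * N * N + (3 : ℂ) • (N * N) + (3 : ℂ) • N := by
      rw [show (3 : ℂ) = 1 + 1 + 1 by norm_num]
      simp only [add_smul, one_smul]
      noncomm_ring
    rw [← hσ, hs3, hNN] at this
    simpa using this.symm
  have hN0 : N = 0 := by simpa using h3
  exact sub_eq_zero.1 hN0

theorem trace_conj_eq {G V : Type} [Group G] [AddCommGroup V] [Module ℂ V]
    (ρ : Representation ℂ G V) {g h : G} (hgh : IsConj g h) :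
    LinearMap.trace ℂ V (ρ g) = LinearMap.trace ℂ V (ρ h) := by
  obtain ⟨c, rfl⟩ := isConj_iff.1 hgh
  rw [map_mul, LinearMap.trace_mul_comm, ← map_mul, ← mul_assoc, inv_mul_cancel, one_mul]

theorem trace_eq_of_sq_eq_one {V : Type} [AddCommGroup V] [Module ℂ V] [Module.Finite ℂ V]
    {T : Module.End ℂ V} (hT : T * T = 1) :
    LinearMap.trace ℂ V T =
      2 * Module.finrank ℂ (LinearMap.range (T + 1)) - Module.finrank ℂ V := by
  have hproj : LinearMap.IsProj (LinearMap.range (T + 1)) ((2⁻¹ : ℂ) • (T + 1)) := by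
    constructor
    · intro v
      exact ⟨(2⁻¹ : ℂ) • v, by simp⟩
    · rintro _ ⟨v, rfl⟩
      have : T (T v) = v := LinearMap.congr_fun hT v
      simp only [LinearMap.smul_apply, LinearMap.add_apply, Module.End.one_apply, map_add, this]
      module
  have h := hproj.trace
  rw [map_smul, map_add, LinearMap.trace_one, smul_eq_mul] at h
  linear_combination 2 * h

theorem trace_eq_of_pow_three_eq_one {V : Type} [AddCommGroup V] [Module ℂ V] [Module.Finite ℂ V]
    {T : Module.End ℂ V} (hT : T ^ 3 = 1) : ∃ r : ℕ,
    LinearMap.trace ℂ V T + LinearMap.trace ℂ V (T ^ 2) = 3 * r - Module.finrank ℂ V := by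
  refine ⟨Module.finrank ℂ (LinearMap.range (1 + T + T ^ 2)), ?_⟩
  have hproj : LinearMap.IsProj (LinearMap.range (1 + T + T ^ 2))
      ((3⁻¹ : ℂ) • (1 + T + T ^ 2)) := by
    constructor
    · intro v
      exact ⟨(3⁻¹ : ℂ) • v, by simp⟩
    · rintro _ ⟨v, rfl⟩
      have h3 : T (T (T v)) = v := LinearMap.congr_fun hT v
      simp only [LinearMap.smul_apply, LinearMap.add_apply, Module.End.one_apply, map_add, pow_two,
        Module.End.mul_apply, h3]
      module
  have h := hproj.trace
  rw [map_smul, map_add, map_add, LinearMap.trace_one, smul_eq_mul] at h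
  linear_combination 3 * h

/-- If a sum of group elements acts as a rational scalar, then this scalar is an integer. -/
theorem exists_intCast_eq {G V : Type} [Group G] [Finite G] [AddCommGroup V] [Module ℂ V]
    [Nontrivial V] (ρ : Representation ℂ G V) {ι : Type} (s : Finset ι) (γ : ι → G) (q : ℚ)
    (h : ∑ i ∈ s, ρ (γ i) = (q : ℂ) • 1) : ∃ z : ℤ, (z : ℚ) = q := by
  let φ : MonoidAlgebra ℤ G →ₐ[ℤ] Module.End ℂ V := MonoidAlgebra.lift ℤ _ _ ρ
  have hfin : Module.Finite ℤ (MonoidAlgebra ℤ G) :=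
    Module.Finite.equiv (MonoidAlgebra.coeffLinearEquiv ℤ).symm
  have h1 : IsIntegral ℤ (φ (∑ i ∈ s, MonoidAlgebra.single (γ i) 1)) :=
    (IsIntegral.of_finite ℤ _).map φ
  have h2 : φ (∑ i ∈ s, MonoidAlgebra.single (γ i) 1) = algebraMap ℂ (Module.End ℂ V) q := by
    rw [map_sum, Algebra.algebraMap_eq_smul_one]
    refine (Finset.sum_congr rfl fun i _ => ?_).trans h
    simp [φ]
  rw [h2] at h1
  have h3 := (isIntegral_algebraMap_iff (algebraMap ℂ (Module.End ℂ V)).injective).1 h1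
  have h4 := (isIntegral_algebraMap_iff (algebraMap ℚ ℂ).injective).1 h3
  exact IsIntegrallyClosed.isIntegral_iff.1 h4

theorem isThreeCycle_eq_one_of_commute_swap {α : Type} [Fintype α] [DecidableEq α] {M : Type}
    [Monoid M] (ρ : Perm α →* M) {a b c : α} (hab : a ≠ b) (hac : a ≠ c) (hbc : b ≠ c)
    (hT : ∀ x, Commute (ρ (swap a b)) x) {g : Perm α} (hg : g.IsThreeCycle) : ρ g = 1 := by
  refine isThreeCycle_eq_one_of_exists ρ (isThreeCycle_swap_mul_swap_same hab hac hbc) ?_ hg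
  have h1 : swap a c = swap b c * swap a b * (swap b c)⁻¹ := by
    rw [mul_swap_eq_swap_mul, swap_apply_left, swap_apply_of_ne_of_ne hab hac, mul_inv_cancel_right]
  have h2 : ρ (swap a c) = ρ (swap a b) := by
    rw [h1, map_mul, map_mul, ← (hT _).eq, mul_assoc, ← map_mul, mul_inv_cancel, map_one, mul_one]
  rw [map_mul, h2, ← map_mul, swap_mul_self, map_one]

theorem FinrankBound.succ {n : ℕ} (hn : 5 ≤ n) (h : FinrankBound n)
    (h' : n ≠ 5 → FinrankBound (n - 1)) : FinrankBound (n + 1) := by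
  intro α _ _ V _ _ _ ρ hα hV g hg
  by_contra hne
  obtain ⟨a, b, c, hab, hac, hbc⟩ := Fintype.two_lt_card_iff.1 (show 2 < Fintype.card α by omega)
  have hcard : Fintype.card {x // x ≠ a} = n := by simp [hα]
  have hdim : Module.finrank ℂ V = n - 1 := by
    by_contra hlt
    refine hne (h.isThreeCycle_eq_one (by omega) (· ≠ a) hcard ρ 0 (fun _ => Commute.zero_right _)
      ?_ ?_ hg)
    · have := Submodule.finrank_le (LinearMap.ker (0 : Module.End ℂ V))
      omega
    · rw [LinearMap.range_zero, finrank_bot]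
      omega
  have hnt : Nontrivial V := Module.nontrivial_of_finrank_pos (R := ℂ) (by omega)
  set X : Module.End ℂ V := ∑ i : {x // x ≠ a}, ρ (swap i.1 a) with hX
  have hXcomm : ∀ h : Perm {x // x ≠ a}, Commute (ρ (ofSubtype h)) X := by
    intro h
    rw [Commute, SemiconjBy, hX, Finset.mul_sum, Finset.sum_mul,
      ← Equiv.sum_comp h (fun i => ρ (swap i.1 a) * ρ (ofSubtype h))]
    refine Finset.sum_congr rfl fun i _ => ?_
    rw [← map_mul, mul_swap_eq_swap_mul, map_mul, ofSubtype_apply_coe,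
      ofSubtype_apply_of_not_mem _ (by simp)]
  obtain ⟨x, hx⟩ := Module.End.exists_eigenvalue X
  have hXx : X = x • 1 := by
    by_contra hXx
    have hf0 : X - x • 1 ≠ 0 := sub_ne_zero.2 hXx
    have hsum := LinearMap.finrank_range_add_finrank_ker (X - x • 1)
    have hr : Module.finrank ℂ (LinearMap.range (X - x • 1)) ≠ 0 := fun h0 =>
      hf0 (LinearMap.range_eq_bot.1 (Submodule.finrank_eq_zero.1 h0))
    have hk : Module.finrank ℂ (LinearMap.ker (X - x • 1)) ≠ 0 := by
      intro h0
      obtain ⟨v, hv⟩ := hx.exists_hasEigenvector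
      have hmem : v ∈ LinearMap.ker (X - x • 1) := by
        simp [hv.apply_eq_smul]
      rw [Submodule.finrank_eq_zero.1 h0] at hmem
      exact hv.2 (by simpa using hmem)
    exact hne (h.isThreeCycle_eq_one (by omega) (· ≠ a) hcard ρ (X - x • 1)
      (fun g => (hXcomm g).sub_right ((Commute.one_right _).smul_right x)) (by omega) (by omega) hg)
  set T := ρ (swap a b) with hT
  have hTT : T * T = 1 := by rw [hT, ← map_mul, swap_mul_self, map_one]
  set p := Module.finrank ℂ (LinearMap.range (T + 1)) with hp
  have hTker := LinearMap.finrank_range_add_finrank_ker (T + 1)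
  have htrT := trace_eq_of_sq_eq_one hTT
  have hn1 : ((n - 1 : ℕ) : ℂ) = n - 1 := by push_cast [show 1 ≤ n by omega]; ring
  have htrX : x * (n - 1) = n * (2 * p - (n - 1)) := by
    have h1 : LinearMap.trace ℂ V X = x * (n - 1) := by
      rw [hXx, map_smul, LinearMap.trace_one, hdim, hn1, smul_eq_mul]
    rw [← h1, hX, map_sum, ← hn1, ← hdim, ← htrT, Finset.sum_congr rfl (g := fun _ =>
      LinearMap.trace ℂ V T), Finset.sum_const, Finset.card_univ, hcard, nsmul_eq_mul]
    intro i _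
    exact trace_conj_eq ρ (isConj_swap i.2 hab)
  have hn0 : ((n : ℂ) - 1) ≠ 0 := by
    rw [← hn1]
    exact Nat.cast_ne_zero.2 (by omega)
  obtain ⟨z, hz⟩ := exists_intCast_eq ρ Finset.univ (fun i : {x // x ≠ a} => swap i.1 a)
    (n * (2 * p - (n - 1)) / (n - 1)) (by
      refine hXx.trans ?_
      congr 1
      push_cast
      rw [eq_div_iff hn0, htrX])
  have hxz : x = z := by
    have : ((z : ℚ) : ℂ) = (n * (2 * p - (n - 1)) / (n - 1) : ℚ) := by rw [hz]
    push_cast at this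
    rw [this, eq_div_iff hn0, htrX]
  have hzZ : z * ((n : ℤ) - 1) = n * (2 * p - (n - 1)) := by
    rw [hxz] at htrX
    exact_mod_cast htrX
  have hdvd : ((n : ℤ) - 1) ∣ 2 * p := by
    refine ⟨z - 2 * p + n, ?_⟩
    linear_combination -hzZ
  have hp0 : p ≠ 0 := by
    intro h0
    have hT1 : T = -1 :=
      eq_neg_of_add_eq_zero_left (LinearMap.range_eq_bot.1 (Submodule.finrank_eq_zero.1 h0))
    refine hne (isThreeCycle_eq_one_of_commute_swap ρ hab hac hbc (fun y => ?_) hg)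
    rw [← hT, hT1]
    exact (Commute.one_left y).neg_left
  have hk0 : Module.finrank ℂ (LinearMap.ker (T + 1)) ≠ 0 := by
    intro h0
    have hker := LinearMap.ker_eq_bot.1 (Submodule.finrank_eq_zero.1 h0)
    have hT1 : T = 1 := by
      ext v
      apply hker
      have : T (T v) = v := LinearMap.congr_fun hTT v
      simp [this, add_comm]
    refine hne (isThreeCycle_eq_one_of_commute_swap ρ hab hac hbc (fun y => ?_) hg)
    rw [← hT, hT1]
    exact Commute.one_left y
  have h2p : 2 * p = n - 1 := by
    obtain ⟨k, hk⟩ := hdvd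
    have hp1 : (p : ℤ) < n - 1 := by omega
    have hp2 : (0 : ℤ) < p := by omega
    have hk1 : k = 1 := by
      have hk0 : 0 < k := by by_contra hneg; nlinarith
      have hk2 : k < 2 := by by_contra hneg; nlinarith
      omega
    subst hk1
    omega
  rcases eq_or_ne n 5 with rfl | hn5
  · have hz0 : x = 0 := by
      have h2p' : (2 * p : ℂ) = 4 := by exact_mod_cast h2p
      have : x * (5 - 1) = 5 * (2 * p - (5 - 1)) := by exact_mod_cast htrX
      rw [h2p'] at this
      linear_combination (1 / 4 : ℂ) * this
    set s := swap a b * swap a c with hs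
    have hs3 : s.IsThreeCycle := isThreeCycle_swap_mul_swap_same hab hac hbc
    have htr : LinearMap.trace ℂ V (T * X) = 4 + 4 * LinearMap.trace ℂ V (ρ s) := by
      rw [hX, Finset.mul_sum, map_sum, Fintype.sum_eq_add_sum_compl ⟨b, hab.symm⟩,
        Finset.sum_congr rfl (g := fun _ => LinearMap.trace ℂ V (ρ s)), Finset.sum_const,
        Finset.card_compl, hcard, Finset.card_singleton, nsmul_eq_mul, hT, ← map_mul, swap_comm b a,
        swap_mul_self, map_one, LinearMap.trace_one, hdim]
      · norm_num
      · intro i hi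
        have hib : i.1 ≠ b := by
          intro hib
          simp [← hib] at hi
        rw [hT, ← map_mul, swap_comm i.1 a]
        exact trace_conj_eq ρ (isConj_iff_cycleType_eq.2
          ((isThreeCycle_swap_mul_swap_same hab i.2.symm hib.symm).trans hs3.symm))
    rw [hXx, hz0, zero_smul, mul_zero, map_zero] at htr
    have hs1 : ρ s ^ 3 = 1 := by rw [← map_pow, ← hs3.orderOf, pow_orderOf_eq_one, map_one]
    obtain ⟨r, hr⟩ := trace_eq_of_pow_three_eq_one hs1
    have hs2 : LinearMap.trace ℂ V (ρ s ^ 2) = LinearMap.trace ℂ V (ρ s) := by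
      rw [← map_pow, pow_two]
      exact trace_conj_eq ρ (isConj_iff_cycleType_eq.2 (hs3.isThreeCycle_sq.trans hs3.symm))
    rw [hs2, hdim] at hr
    have h3r : (3 * r : ℂ) = 2 := by
      push_cast at hr
      linear_combination -hr - (1 / 2 : ℂ) * htr
    have : 3 * r = 2 := by exact_mod_cast h3r
    omega
  · refine hne ((h' hn5).isThreeCycle_eq_one (by omega) (fun x => x ≠ a ∧ x ≠ b) ?_ ρ (T + 1)
      (fun h => ?_) (by omega) (by omega) hg)
    · rw [Fintype.card_subtype]
      have : (Finset.univ.filter fun x => x ≠ a ∧ x ≠ b) = {a, b}ᶜ := by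
        ext x
        simp
      rw [this, Finset.card_compl, Finset.card_pair hab, hα]
      omega
    · refine Commute.add_right ?_ (Commute.one_right _)
      rw [Commute, SemiconjBy, hT, ← map_mul, mul_swap_eq_swap_mul, map_mul,
        ofSubtype_apply_of_not_mem _ (by simp), ofSubtype_apply_of_not_mem _ (by simp)]

theorem finrankBound {n : ℕ} (hn : 5 ≤ n) : FinrankBound n := by
  induction n using Nat.strong_induction_on with
  | _ n ih =>
    obtain rfl | hn' := hn.eq_or_lt
    · exact finrankBound_five
    · obtain ⟨k, rfl⟩ : ∃ k, n = k + 1 := ⟨n - 1, by omega⟩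
      exact (ih k (by omega) (by omega)).succ (by omega) fun h => ih _ (by omega) (by omega)
end

theorem isIrreducible_of_forall {G V : Type} [Group G] [AddCommGroup V] [Module ℂ V] [Nontrivial V]
    (ρ : Representation ℂ G V)
    (h : ∀ W : Subrepresentation ρ, ∀ v ∈ W, v ≠ 0 → ∀ u, u ∈ W) : IsIrreducible ρ := by
  obtain ⟨v, hv⟩ := exists_ne (0 : V)
  have : Nontrivial (Subrepresentation ρ) := by
    refine ⟨⊥, ⊤, fun h => hv ?_⟩
    have : v ∈ (⊤ : Subrepresentation ρ) := trivial
    rw [← h] at this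
    exact this
  refine ⟨fun W => ?_⟩
  by_cases hW : ∃ w ∈ W, w ≠ 0
  · obtain ⟨w, hw, hw0⟩ := hW
    exact Or.inr (le_antisymm le_top fun u _ => h W w hw hw0 u)
  · push Not at hW
    exact Or.inl (le_antisymm (fun w hw => hW w hw) bot_le)

section
open Equiv Equiv.Perm

/-- The permutation representation of `Perm α` on functions `α → ℂ`. -/
def permFun (α : Type) : Representation ℂ (Perm α) (α → ℂ) where
  toFun g := LinearMap.funLeft ℂ ℂ g.symm
  map_one' := rfl
  map_mul' _ _ := rfl

theorem permFun_apply {α : Type} (g : Perm α) (f : α → ℂ) (i : α) :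
    permFun α g f i = f (g.symm i) := rfl

/-- The functions with sum zero, as a subrepresentation of the permutation representation. -/
def permSumZero (α : Type) [Fintype α] : Subrepresentation (permFun α) where
  toSubmodule := LinearMap.ker (∑ i, LinearMap.proj i : (α → ℂ) →ₗ[ℂ] ℂ)
  apply_mem_toSubmodule g f hf := by
    simp only [LinearMap.mem_ker, LinearMap.coe_sum, Finset.sum_apply, LinearMap.coe_proj,
      Function.eval, permFun_apply] at hf ⊢
    rw [← hf]
    exact Equiv.sum_comp g.symm f

theorem mem_permSumZero {α : Type} [Fintype α] {f : α → ℂ} :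
    f ∈ (permSumZero α).toSubmodule ↔ ∑ i, f i = 0 := by
  simp [permSumZero]

theorem isIrreducible_permSumZero {α : Type} [Fintype α] [DecidableEq α]
    (hα : 1 < Fintype.card α) : IsIrreducible (permSumZero α).toRepresentation := by
  have hmem : ∀ i j : α, Pi.single i (1 : ℂ) - Pi.single j 1 ∈ (permSumZero α).toSubmodule := by
    intro i j
    simp [mem_permSumZero]
  obtain ⟨a, b, hab⟩ := Fintype.one_lt_card_iff.1 hα
  have : Nontrivial (permSumZero α).toSubmodule := by
    refine ⟨⟨_, hmem a b⟩, 0, fun h => ?_⟩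
    have := congrFun (congrArg Subtype.val h) a
    simp [hab] at this
  refine isIrreducible_of_forall _ fun W w hw hw0 u => ?_
  have hne : ∃ i j, w.1 i ≠ w.1 j := by
    by_contra! hc
    have h0 := mem_permSumZero.1 w.2
    rw [Finset.sum_congr rfl fun i _ => hc i a, Finset.sum_const, nsmul_eq_mul] at h0
    have ha : w.1 a = 0 := (mul_eq_zero.1 h0).resolve_left
      (Nat.cast_ne_zero.2 (by rw [Finset.card_univ]; omega))
    exact hw0 (Subtype.ext (funext fun i => (hc i a).trans ha))
  obtain ⟨i, j, hij⟩ := hne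
  have hij' : i ≠ j := fun h => hij (by rw [h])
  let E (k l : α) : (permSumZero α).toSubmodule := ⟨_, hmem k l⟩
  have hE : E i j ∈ W.toSubmodule := by
    have h1 : w - (permSumZero α).toRepresentation (swap i j) w ∈ W.toSubmodule :=
      W.toSubmodule.sub_mem hw (W.apply_mem_toSubmodule _ hw)
    have h2 : w - (permSumZero α).toRepresentation (swap i j) w = (w.1 i - w.1 j) • E i j := by
      ext k
      change w.1 k - w.1 ((swap i j).symm k) = (w.1 i - w.1 j) *
        ((Pi.single i 1 : α → ℂ) k - (Pi.single j 1 : α → ℂ) k)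
      rw [symm_swap]
      rcases eq_or_ne k i with rfl | hki
      · simp [hij']
      · rcases eq_or_ne k j with rfl | hkj
        · simp [hij'.symm]
        · simp [swap_apply_of_ne_of_ne hki hkj, hki, hkj]
    rw [h2] at h1
    exact (W.toSubmodule.smul_mem_iff (sub_ne_zero.2 hij)).1 h1
  have hE' : ∀ k, E k j ∈ W.toSubmodule := by
    intro k
    rcases eq_or_ne k j with rfl | hkj
    · convert W.toSubmodule.zero_mem
      exact Subtype.ext (sub_self _)
    · convert W.apply_mem_toSubmodule (swap i k) hE
      ext l
      change (Pi.single k 1 : α → ℂ) l - (Pi.single j 1 : α → ℂ) l =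
        (Pi.single i 1 : α → ℂ) ((swap i k).symm l) - (Pi.single j 1 : α → ℂ) ((swap i k).symm l)
      rw [symm_swap]
      simp only [Pi.single_apply]
      congr 2
      · rw [swap_apply_eq_iff, swap_apply_left]
      · rw [swap_apply_eq_iff, swap_apply_of_ne_of_ne hij'.symm hkj.symm]
  have hu : u = ∑ k, u.1 k • E k j := by
    ext l
    have h0 := mem_permSumZero.1 u.2
    simp [E, mul_sub, Finset.sum_sub_distrib, Pi.single_apply, h0]
  change u ∈ W.toSubmodule
  rw [hu]
  exact W.toSubmodule.sum_mem fun k _ => W.toSubmodule.smul_mem _ (hE' k)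

theorem exists_mem_cd_perm {m : ℕ} (hm : 3 ≤ m) : ∃ d ∈ cd (Perm (Fin m)), 1 < d ∧ d < m := by
  refine ⟨_, mem_cd_iff.2 ⟨_, _, _, inferInstance, (permSumZero (Fin m)).toRepresentation,
    isIrreducible_permSumZero (by simp; omega), rfl⟩, ?_, ?_⟩
  · have h1 := LinearMap.finrank_range_add_finrank_ker
      (∑ i, LinearMap.proj i : (Fin m → ℂ) →ₗ[ℂ] ℂ)
    have h2 := Submodule.finrank_le
      (LinearMap.range (∑ i, LinearMap.proj i : (Fin m → ℂ) →ₗ[ℂ] ℂ))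
    rw [Module.finrank_self] at h2
    rw [Module.finrank_fin_fun] at h1
    change 1 < Module.finrank ℂ (LinearMap.ker (∑ i, LinearMap.proj i : (Fin m → ℂ) →ₗ[ℂ] ℂ))
    omega
  · have : (permSumZero (Fin m)).toSubmodule ≠ ⊤ := by
      intro h
      have : Pi.single ⟨0, by omega⟩ (1 : ℂ) ∈ (permSumZero (Fin m)).toSubmodule := h ▸ trivial
      simp [mem_permSumZero] at this
    simpa using Submodule.finrank_lt this

theorem finrank_eq_one_of_commute {G V : Type} [Group G] [AddCommGroup V] [Module ℂ V]
    [Module.Finite ℂ V] (ρ : Representation ℂ G V) [IsIrreducible ρ]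
    (h : ∀ g k, Commute (ρ g) (ρ k)) : Module.finrank ℂ V = 1 := by
  have hnt : Nontrivial V := IsSimpleModule.nontrivial (MonoidAlgebra ℂ G) ρ.asModule
  have htop : ∀ W : Subrepresentation ρ, ∀ v ∈ W, v ≠ 0 → ∀ u, u ∈ W := by
    intro W v hv hv0 u
    rcases eq_bot_or_eq_top W with rfl | rfl
    · exact absurd hv hv0
    · trivial
  have hscalar : ∀ g, ∃ x : ℂ, ∀ u, ρ g u = x • u := by
    intro g
    obtain ⟨x, hx⟩ := Module.End.exists_eigenvalue (ρ g)
    obtain ⟨v, hv⟩ := hx.exists_hasEigenvector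
    let W : Subrepresentation ρ := ⟨Module.End.eigenspace (ρ g) x, fun k u hu => by
      rw [Module.End.mem_eigenspace_iff] at hu ⊢
      rw [← Module.End.mul_apply, (h g k).eq, Module.End.mul_apply, hu, map_smul]⟩
    exact ⟨x, fun u => Module.End.mem_eigenspace_iff.1 (htop W v hv.1 hv.2 u)⟩
  obtain ⟨v, hv⟩ := exists_ne (0 : V)
  let W : Subrepresentation ρ := ⟨ℂ ∙ v, fun g u hu => by
    obtain ⟨x, hx⟩ := hscalar g
    rw [hx]
    exact Submodule.smul_mem _ _ hu⟩
  have hW : (ℂ ∙ v) = ⊤ :=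
    eq_top_iff.2 fun u _ => htop W v (Submodule.mem_span_singleton_self v) hv u
  rw [← finrank_top, ← hW, finrank_span_singleton hv]

theorem le_of_mem_cd_perm {n d : ℕ} (hn : 5 ≤ n) (hd : d ∈ cd (Perm (Fin n))) (h1 : d ≠ 1) :
    n ≤ d + 1 := by
  obtain ⟨V, _, _, _, ρ, hρ, rfl⟩ := mem_cd_iff.1 hd
  by_contra! hlt
  refine h1 (finrank_eq_one_of_commute ρ fun g k => ?_)
  have halt : alternatingGroup (Fin n) ≤ MonoidHom.ker ρ := by
    rw [← closure_three_cycles_eq_alternating, Subgroup.closure_le]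
    exact fun s hs => finrankBound hn _ _ ρ (Fintype.card_fin n) hlt s hs
  have hgk : ρ (g * k * (k * g)⁻¹) = 1 := halt (by simp)
  calc ρ g * ρ k = ρ (g * k * (k * g)⁻¹ * (k * g)) := by rw [inv_mul_cancel_right, map_mul]
    _ = ρ k * ρ g := by rw [map_mul, hgk, one_mul, map_mul]

theorem not_cd_perm_subset_of_lt {m n : ℕ} (hn : 5 ≤ n) (hmn : n < m) :
    ¬ cd (Perm (Fin m)) ⊆ cd (Perm (Fin n)) := by
  intro h
  have hbdd : BddAbove (cd (Perm (Fin n))) := by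
    refine ⟨Nat.card (Perm (Fin n)), fun d hd => ?_⟩
    obtain ⟨V, _, _, _, ρ, hρ, rfl⟩ := mem_cd_iff.1 hd
    exact finrank_le_natCard ρ
  obtain ⟨d, hd, -⟩ := exists_mem_cd_perm (show 3 ≤ n by omega)
  obtain ⟨V, _, _, _, ρ, hρ, hdim⟩ := mem_cd_iff.1 (Nat.sSup_mem ⟨d, hd⟩ hbdd)
  let f : Fin n ↪ Fin m := Fin.castLEEmb hmn.le
  refine not_cd_subset (viaEmbeddingHom f) (viaEmbeddingHom_injective f) (fun k hk => ?_)
    ((Units.map (Int.castRingHom ℂ).toMonoidHom).comp sign) (fun hχ => ?_) _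
    (fun W _ _ _ σ hσ => le_csSup hbdd (h (mem_cd_iff.2 ⟨W, _, _, inferInstance, σ, hσ, rfl⟩)))
    V ρ hdim
  · ext i : 1
    by_contra hi
    have hi : k i ≠ i := hi
    have hz : (⟨n, hmn⟩ : Fin m) ∉ Set.range f := by
      rintro ⟨j, hj⟩
      have := congrArg Fin.val hj
      have hlt := j.2
      change j.1 = n at this
      omega
    generalize (⟨n, hmn⟩ : Fin m) = z at hz
    obtain ⟨l, hl⟩ := hk (swap (f i) z)
    have h1 := congrArg (· z) hl
    simp only [viaEmbeddingHom_apply, swap_inv, Perm.mul_apply, swap_apply_right,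
      viaEmbedding_apply, viaEmbedding_apply_of_notMem _ _ _ hz] at h1
    rw [swap_apply_of_ne_of_ne (f.injective.ne hi) (fun h => hz ⟨_, h⟩)] at h1
    exact hz ⟨_, h1.symm⟩
  · have h1 := congrArg Units.val (DFunLike.congr_fun hχ (swap ⟨0, by omega⟩ ⟨1, by omega⟩))
    rw [MonoidHom.comp_apply, sign_swap (by simp)] at h1
    norm_num at h1
end

theorem stmt16 (m n : ℕ) (hm : 5 ≤ m) (hn : 5 ≤ n)
    (h : cd (Equiv.Perm (Fin m)) ⊆ cd (Equiv.Perm (Fin n))) : m = n := by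
  rcases lt_trichotomy m n with hmn | hmn | hmn
  · obtain ⟨d, hd, h1, h2⟩ := exists_mem_cd_perm (show 3 ≤ m by omega)
    have := le_of_mem_cd_perm hn (h hd) h1.ne'
    omega
  · exact hmn
  · exact absurd h (not_cd_perm_subset_of_lt hn hmn)
end

section
/- Let m, n ≥ 5 be integers. If cd(A_m) ⊆ cd(S_n), then m = n. -/
open CategoryTheory

namespace Representation

variable {G V : Type} [Group G] [AddCommGroup V] [Module ℂ V]

/-- A representation is irreducible iff it is nonzero and every invariant submodule is trivial. -/
theorem isIrreducible_iff_forall (ρ : Representation ℂ G V) :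
    ρ.IsIrreducible ↔ Nontrivial V ∧
      ∀ W : Submodule ℂ V, (∀ g, ∀ w ∈ W, ρ g w ∈ W) → W = ⊥ ∨ W = ⊤ := by
  constructor
  · intro h
    refine ⟨?_, fun W hW => ?_⟩
    · by_contra hV
      rw [not_nontrivial_iff_subsingleton] at hV
      obtain ⟨a, b, hab⟩ := h.toNontrivial
      refine hab (Subrepresentation.toSubmodule_injective (Subsingleton.elim _ _))
    · rcases h.eq_bot_or_eq_top ⟨W, fun g w hw => hW g w hw⟩ with h | h
      · exact Or.inl (congrArg Subrepresentation.toSubmodule h)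
      · exact Or.inr (congrArg Subrepresentation.toSubmodule h)
  · rintro ⟨hV, h⟩
    refine { exists_pair_ne := ⟨⊥, ⊤, fun e => ?_⟩, eq_bot_or_eq_top := fun W => ?_ }
    · exact bot_ne_top (α := Submodule ℂ V) (congrArg Subrepresentation.toSubmodule e)
    · rcases h W.toSubmodule (fun g w hw => W.apply_mem_toSubmodule g hw) with h | h
      · exact Or.inl (Subrepresentation.toSubmodule_injective h)
      · exact Or.inr (Subrepresentation.toSubmodule_injective h)

/-- Maschke's theorem for invariant submodules. -/
theorem exists_isCompl_of_invariant [Finite G] (ρ : Representation ℂ G V) (W : Submodule ℂ V)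
    (hW : ∀ g, ∀ w ∈ W, ρ g w ∈ W) :
    ∃ W' : Submodule ℂ V, IsCompl W W' ∧ ∀ g, ∀ w ∈ W', ρ g w ∈ W' := by
  have : NeZero (Nat.card G : ℂ) := ⟨by exact_mod_cast Nat.card_pos.ne'⟩
  obtain ⟨U, hU⟩ := exists_isCompl (⟨W, fun g w hw => hW g w hw⟩ : Subrepresentation ρ)
  refine ⟨U.toSubmodule, ⟨?_, ?_⟩, fun g w hw => U.apply_mem_toSubmodule g hw⟩
  · rw [disjoint_iff]
    exact congrArg Subrepresentation.toSubmodule (disjoint_iff.1 hU.1)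
  · rw [codisjoint_iff]
    exact congrArg Subrepresentation.toSubmodule (codisjoint_iff.1 hU.2)

theorem isIrreducible_of_finrank_intertwiningMap [Finite G] [FiniteDimensional ℂ V]
    (ρ : Representation ℂ G V) (h : Module.finrank ℂ (IntertwiningMap ρ ρ) = 1) :
    ρ.IsIrreducible := by
  rw [isIrreducible_iff_forall]
  constructor
  · by_contra hV
    rw [not_nontrivial_iff_subsingleton] at hV
    have : Subsingleton (IntertwiningMap ρ ρ) := ⟨fun a b => by ext x; exact Subsingleton.elim _ _⟩
    rw [Module.finrank_zero_of_subsingleton] at h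
    exact zero_ne_one h
  · intro W hW
    obtain ⟨U, hU, hUi⟩ := exists_isCompl_of_invariant ρ W hW
    let P : V →ₗ[ℂ] V := W.subtype ∘ₗ W.projectionOnto U hU
    have hPW : ∀ w ∈ W, P w = w := fun w hw => by
      have := Submodule.projectionOnto_apply_left hU ⟨w, hw⟩
      simp only [P, LinearMap.comp_apply]
      exact congrArg Subtype.val this
    have hPU : ∀ w ∈ U, P w = 0 := fun w hw => by
      have := Submodule.projectionOnto_apply_right hU ⟨w, hw⟩
      simp only [P, LinearMap.comp_apply]
      exact congrArg Subtype.val this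
    have hsplit : ∀ v : V, ∃ a ∈ W, ∃ b ∈ U, a + b = v := fun v =>
      Submodule.mem_sup.1 (hU.sup_eq_top ▸ Submodule.mem_top)
    let F : IntertwiningMap ρ ρ := ⟨P, fun g => by
      ext v
      obtain ⟨a, ha, b, hb, rfl⟩ := hsplit v
      simp only [LinearMap.comp_apply, map_add, hPW a ha, hPU b hb, hPW _ (hW g a ha),
        hPU _ (hUi g b hb), map_zero]⟩
    have hid : (IntertwiningMap.id ρ) ≠ 0 := by
      intro h0
      have h1 : ∀ f : IntertwiningMap ρ ρ, f = 0 := fun f => by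
        ext v
        have : (IntertwiningMap.id ρ) v = (0 : IntertwiningMap ρ ρ) v := by rw [h0]
        have hv : v = 0 := this
        rw [hv]; simp
      have : Subsingleton (IntertwiningMap ρ ρ) := ⟨fun a b => (h1 a).trans (h1 b).symm⟩
      rw [Module.finrank_zero_of_subsingleton] at h
      exact zero_ne_one h
    obtain ⟨c, hc⟩ := (finrank_eq_one_iff_of_nonzero' _ hid).1 h F
    have hc' : ∀ v, c • v = P v := fun v => by
      have : (c • IntertwiningMap.id ρ) v = F v := by rw [hc]
      exact this
    by_cases h0 : c = 0
    · left
      rw [Submodule.eq_bot_iff]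
      intro w hw
      rw [← hPW w hw, ← hc', h0, zero_smul]
    · right
      have : U = ⊥ := by
        rw [Submodule.eq_bot_iff]
        intro w hw
        have := hc' w
        rw [hPU w hw] at this
        exact (smul_eq_zero.1 this).resolve_left h0
      have h2 := hU.sup_eq_top
      rwa [this, sup_bot_eq] at h2

/-- The norm of an irreducible character. -/
theorem IsIrreducible.sum_character_mul [Fintype G] [FiniteDimensional ℂ V]
    {ρ : Representation ℂ G V} (h : ρ.IsIrreducible) :
    ∑ g : G, ρ.character g * ρ.character g⁻¹ = Nat.card G := by
  have hne : (Nat.card G : ℂ) ≠ 0 := by exact_mod_cast Nat.card_pos.ne'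
  have := invertibleOfNonzero hne
  have h1 := char_orthonormal ρ ρ
  rw [if_pos ⟨Equiv.refl ρ⟩] at h1
  field_simp at h1
  exact h1

end Representation

theorem finrank_mem_cd {G V : Type} [Group G] [Finite G] [AddCommGroup V] [Module ℂ V]
    [FiniteDimensional ℂ V] {ρ : Representation ℂ G V} (h : ρ.IsIrreducible) :
    Module.finrank ℂ V ∈ cd G := by
  have := Fintype.ofFinite G
  refine ⟨FDRep.of ρ, ?_, rfl⟩
  rw [FDRep.simple_iff_char_is_norm_one]
  exact h.sum_character_mul

theorem exists_irreducible_of_mem_cd {G : Type} [Group G] [Finite G] {d : ℕ} (hd : d ∈ cd G) :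
    ∃ (V : Type) (_ : AddCommGroup V) (_ : Module ℂ V) (_ : FiniteDimensional ℂ V)
      (ρ : Representation ℂ G V), ρ.IsIrreducible ∧ Module.finrank ℂ V = d := by
  have := Fintype.ofFinite G
  obtain ⟨V, hV, hd⟩ := hd
  have hne : (Nat.card G : ℂ) ≠ 0 := by exact_mod_cast Nat.card_pos.ne'
  have := invertibleOfNonzero hne
  refine ⟨V, inferInstance, inferInstance, inferInstance, V.ρ, ?_, hd⟩
  apply Representation.isIrreducible_of_finrank_intertwiningMap
  have h1 := (FDRep.simple_iff_char_is_norm_one V).1 hV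
  have h2 := Representation.card_inv_mul_sum_char_mul_char_eq_finrank V.ρ V.ρ
  have h3 : ∑ g : G, Representation.character V.ρ g * Representation.character V.ρ g⁻¹
      = Nat.card G := h1
  rw [h3, inv_mul_cancel₀ hne] at h2
  exact_mod_cast h2.symm

section Wedderburn

open scoped MonoidAlgebra

variable {G : Type} [Group G] {k : ℕ} {d : Fin k → ℕ}

theorem exists_algEquiv_pi_matrix (G : Type) [Group G] [Finite G] :
    ∃ (k : ℕ) (d : Fin k → ℕ), (∀ i, NeZero (d i)) ∧
      Nonempty (ℂ[G] ≃ₐ[ℂ] Π i, Matrix (Fin (d i)) (Fin (d i)) ℂ) := by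
  have : NeZero (Nat.card G : ℂ) := ⟨by exact_mod_cast Nat.card_pos.ne'⟩
  exact IsSemisimpleRing.exists_algEquiv_pi_matrix_of_isAlgClosed ℂ ℂ[G]

theorem sum_sq_eq_card [Finite G] (e : ℂ[G] ≃ₐ[ℂ] Π i, Matrix (Fin (d i)) (Fin (d i)) ℂ) :
    ∑ i, d i ^ 2 = Nat.card G := by
  have := Fintype.ofFinite G
  have h1 : Module.finrank ℂ ℂ[G] = Nat.card G := by
    rw [(MonoidAlgebra.coeffLinearEquiv ℂ (S := ℂ) (M := G)).finrank_eq,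
      Module.finrank_finsupp_self, Nat.card_eq_fintype_card]
  rw [← h1, e.toLinearEquiv.finrank_eq, Module.finrank_pi_fintype]
  simp [Module.finrank_matrix, sq]

/-- The simple representation attached to a block of the group algebra. -/
noncomputable def blockRep (e : ℂ[G] ≃ₐ[ℂ] Π i, Matrix (Fin (d i)) (Fin (d i)) ℂ) (i : Fin k) :
    Representation ℂ G (Fin (d i) → ℂ) :=
  (((Matrix.toLinAlgEquiv' : Matrix (Fin (d i)) (Fin (d i)) ℂ ≃ₐ[ℂ] _).toAlgHom.comp
    (Pi.evalAlgHom ℂ _ i)).comp e.toAlgHom : ℂ[G] →* _).comp (MonoidAlgebra.of ℂ G)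

theorem blockRep_isIrreducible (e : ℂ[G] ≃ₐ[ℂ] Π i, Matrix (Fin (d i)) (Fin (d i)) ℂ) (i : Fin k)
    [NeZero (d i)] : (blockRep e i).IsIrreducible := by
  rw [Representation.isIrreducible_iff_forall]
  refine ⟨inferInstance, fun W hW => ?_⟩
  have hall : ∀ (M : Matrix (Fin (d i)) (Fin (d i)) ℂ), ∀ w ∈ W, M.mulVec w ∈ W := by
    have key : ∀ (a : ℂ[G]), ∀ w ∈ W, (e a i).mulVec w ∈ W := by
      intro a w hw
      induction a using MonoidAlgebra.induction_on with
      | of g => exact hW g w hw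
      | add x y hx hy =>
        rw [map_add, Pi.add_apply, Matrix.add_mulVec]
        exact W.add_mem hx hy
      | smul r x hx =>
        rw [map_smul, Pi.smul_apply, Matrix.smul_mulVec]
        exact W.smul_mem r hx
    intro M w hw
    have := key (e.symm (Pi.single i M)) w hw
    simpa using this
  by_cases h : W = ⊥
  · exact Or.inl h
  right
  obtain ⟨w, hw, hw0⟩ := Submodule.exists_mem_ne_zero_of_ne_bot h
  obtain ⟨j, hj⟩ := Function.ne_iff.1 hw0
  have hbasis : ∀ l, (Pi.single l (w j) : Fin (d i) → ℂ) ∈ W := fun l => by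
    have := hall (Matrix.single l j 1) w hw
    have h2 : (Matrix.single l j (1 : ℂ)).mulVec w = Pi.single l (w j) := by
      rw [Matrix.single_mulVec]; ext x; simp [Function.update_apply, Pi.single_apply]
    rwa [h2] at this
  rw [eq_top_iff]
  intro v _
  have : v = ∑ l, (v l / w j) • (Pi.single l (w j) : Fin (d i) → ℂ) := by
    ext x
    rw [Finset.sum_apply, Finset.sum_eq_single x]
    · have : w j ≠ 0 := hj
      simp [this]
    · intro b _ hb
      simp [hb.symm]
    · simp
  rw [this]
  exact W.sum_mem fun l _ => W.smul_mem _ (hbasis l)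

theorem block_mem_cd [Finite G] (e : ℂ[G] ≃ₐ[ℂ] Π i, Matrix (Fin (d i)) (Fin (d i)) ℂ) (i : Fin k)
    [NeZero (d i)] : d i ∈ cd G := by
  have := finrank_mem_cd (blockRep_isIrreducible e i)
  simpa using this

theorem card_blocks_le [Finite G] (e : ℂ[G] ≃ₐ[ℂ] Π i, Matrix (Fin (d i)) (Fin (d i)) ℂ)
    (hd : ∀ i, NeZero (d i)) : k ≤ Nat.card (ConjClasses G) := by
  have := Fintype.ofFinite (ConjClasses G)
  let z : (Fin k → ℂ) →ₗ[ℂ] ℂ[G] :=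
    e.symm.toLinearMap ∘ₗ LinearMap.pi fun i =>
      (Algebra.linearMap ℂ (Matrix (Fin (d i)) (Fin (d i)) ℂ)) ∘ₗ LinearMap.proj i
  have hez : ∀ c i, e (z c) i = algebraMap ℂ _ (c i) := fun c i => by simp [z]
  have hz : Function.Injective z := by
    intro a b hab
    ext i
    have h1 := hez a i
    rw [hab, hez b i] at h1
    exact (FaithfulSMul.algebraMap_injective ℂ (Matrix (Fin (d i)) (Fin (d i)) ℂ) h1).symm
  have hcomm : ∀ c a, z c * a = a * z c := fun c a => by
    apply e.injective
    ext1 i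
    rw [map_mul, map_mul, Pi.mul_apply, Pi.mul_apply, hez]
    exact Algebra.commutes _ _
  have hconj : ∀ c (g h : G), IsConj g h → (z c).coeff g = (z c).coeff h := by
    intro c g h hgh
    obtain ⟨x, hx⟩ := isConj_iff.1 hgh
    have h1 := congrArg (fun y => y.coeff (x * g)) (hcomm c (MonoidAlgebra.single x 1))
    simp only [MonoidAlgebra.coeff_mul_single_apply, MonoidAlgebra.coeff_single_mul_apply] at h1
    rw [hx] at h1
    simpa using h1.symm
  let f : (Fin k → ℂ) →ₗ[ℂ] (ConjClasses G → ℂ) :=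
    LinearMap.pi fun C => Finsupp.lapply (Quotient.out C) ∘ₗ
      (MonoidAlgebra.coeffLinearEquiv ℂ (S := ℂ) (M := G)).toLinearMap ∘ₗ z
  have hf : Function.Injective f := by
    intro a b hab
    apply hz
    ext g
    have h1 : (z a).coeff (Quotient.out (ConjClasses.mk g))
        = (z b).coeff (Quotient.out (ConjClasses.mk g)) := congrFun hab (ConjClasses.mk g)
    have h2 : IsConj (Quotient.out (ConjClasses.mk g)) g :=
      ConjClasses.mk_eq_mk_iff_isConj.1 (Quotient.out_eq (ConjClasses.mk g))
    rwa [hconj a _ _ h2, hconj b _ _ h2] at h1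
  have := LinearMap.finrank_le_finrank_of_injective hf
  rw [Nat.card_eq_fintype_card]
  simpa using this

/-- If the squares of all degrees are at most `B`, then `|G|` is at most `B` times the
class number. -/
theorem card_le_of_forall_mem_cd [Finite G] {B : ℕ} (h : ∀ x ∈ cd G, x ^ 2 ≤ B) :
    Nat.card G ≤ Nat.card (ConjClasses G) * B := by
  obtain ⟨k, d, hd, ⟨e⟩⟩ := exists_algEquiv_pi_matrix G
  rw [← sum_sq_eq_card e]
  calc ∑ i, d i ^ 2 ≤ ∑ _i : Fin k, B := Finset.sum_le_sum fun i _ => h _ (block_mem_cd e i)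
    _ = k * B := by simp
    _ ≤ _ := Nat.mul_le_mul_right _ (card_blocks_le e hd)

theorem sq_le_card_of_mem_cd [Finite G] {x : ℕ} (hx : x ∈ cd G) : x ^ 2 ≤ Nat.card G := by
  obtain ⟨V, _, _, _, ρ, hρ, rfl⟩ := exists_irreducible_of_mem_cd hx
  obtain ⟨k, d, hd, ⟨e⟩⟩ := exists_algEquiv_pi_matrix G
  let ψ : (Π i, Matrix (Fin (d i)) (Fin (d i)) ℂ) →ₐ[ℂ] Module.End ℂ V :=
    ρ.asAlgebraHom.comp e.symm.toAlgHom
  have hψ : ∀ g, ψ (e (MonoidAlgebra.of ℂ G g)) = ρ g := fun g => by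
    simp [ψ]
  have := ((Representation.isIrreducible_iff_forall ρ).1 hρ).1
  have hex : ∃ i j, ψ (Pi.single i (Matrix.single j j 1)) ≠ 0 := by
    by_contra! hcon
    have h1 : (1 : Π i, Matrix (Fin (d i)) (Fin (d i)) ℂ)
        = ∑ i, ∑ j, Pi.single i (Matrix.single j j 1) := by
      ext1 i
      rw [Finset.sum_apply, Finset.sum_eq_single i]
      · rw [Finset.sum_apply]
        simp only [Pi.single_eq_same]
        ext a b
        simp [Matrix.sum_apply, Matrix.one_apply, Matrix.single_apply, ite_and]
      · intro b _ hb
        rw [Finset.sum_apply]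
        exact Finset.sum_eq_zero fun j _ => by simp [hb.symm]
      · simp
    have h2 : (1 : Module.End ℂ V) = 0 := by
      rw [← map_one ψ, h1, map_sum]
      refine Finset.sum_eq_zero fun i _ => ?_
      rw [map_sum]
      exact Finset.sum_eq_zero fun j _ => hcon i j
    exact one_ne_zero h2
  obtain ⟨i, j, hij⟩ := hex
  obtain ⟨v, hv⟩ : ∃ v, ψ (Pi.single i (Matrix.single j j 1)) v ≠ 0 := by
    by_contra! h
    exact hij (LinearMap.ext h)
  let col : (Fin (d i) → ℂ) →ₗ[ℂ] Matrix (Fin (d i)) (Fin (d i)) ℂ :=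
    { toFun := fun c => Matrix.vecMulVec c (Pi.single j 1)
      map_add' := fun a b => Matrix.add_vecMulVec a b _
      map_smul' := fun r a => Matrix.smul_vecMulVec r a _ }
  let f : (Fin (d i) → ℂ) →ₗ[ℂ] V :=
    LinearMap.applyₗ v ∘ₗ ψ.toLinearMap ∘ₗ LinearMap.single ℂ _ i ∘ₗ col
  have hf : ∀ c, f c = ψ (Pi.single i (Matrix.vecMulVec c (Pi.single j 1))) v := fun c => rfl
  have hfv : f (Pi.single j 1) ≠ 0 := by
    rw [hf]
    convert hv using 4
    ext a b
    simp only [Matrix.vecMulVec_apply, Pi.single_apply, Matrix.single_apply]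
    grind
  have hinv : ∀ g, ∀ w ∈ LinearMap.range f, ρ g w ∈ LinearMap.range f := by
    rintro g _ ⟨c, rfl⟩
    refine ⟨(e (MonoidAlgebra.of ℂ G g) i).mulVec c, ?_⟩
    rw [hf, hf, ← hψ, ← Module.End.mul_apply, ← map_mul]
    congr 2
    ext1 i'
    by_cases h : i' = i
    · subst h
      simp [Matrix.mul_vecMulVec]
    · simp [h]
  have htop : LinearMap.range f = ⊤ := by
    refine (((Representation.isIrreducible_iff_forall ρ).1 hρ).2 _ hinv).resolve_left fun h => ?_
    exact hfv (LinearMap.range_eq_bot.1 h ▸ rfl)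
  have hle : Module.finrank ℂ V ≤ d i := by
    have := LinearMap.finrank_range_le f
    rw [htop, finrank_top] at this
    simpa using this
  rw [← sum_sq_eq_card e]
  exact (Nat.pow_le_pow_left hle 2).trans
    (Finset.single_le_sum (f := fun i => d i ^ 2) (fun _ _ => Nat.zero_le _) (Finset.mem_univ i))

end Wedderburn

namespace Representation

variable {G V : Type} [Group G] [AddCommGroup V] [Module ℂ V]

/-- Schur's lemma. -/
theorem IsIrreducible.exists_eq_smul [FiniteDimensional ℂ V] {ρ : Representation ℂ G V}
    (h : ρ.IsIrreducible) (T : Module.End ℂ V) (hT : ∀ g v, T (ρ g v) = ρ g (T v)) :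
    ∃ c : ℂ, ∀ v, T v = c • v := by
  obtain ⟨hV, hirr⟩ := ρ.isIrreducible_iff_forall.1 h
  obtain ⟨c, hc⟩ := Module.End.exists_eigenvalue T
  refine ⟨c, fun v => ?_⟩
  have := (hirr (Module.End.eigenspace T c) fun g w hw => ?_).resolve_left hc
  · exact Module.End.mem_eigenspace_iff.1 (this ▸ Submodule.mem_top)
  · rw [Module.End.mem_eigenspace_iff] at hw ⊢
    rw [hT, hw, map_smul]

theorem isIntegral_character [Finite G] [FiniteDimensional ℂ V] (ρ : Representation ℂ G V) (g : G) :
    IsIntegral ℤ (ρ.character g) := by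
  have : ρ.character g = (ρ g).charpoly.roots.sum :=
    Module.End.trace_eq_sum_roots_charpoly_of_splits (IsAlgClosed.splits _)
  rw [this]
  refine IsIntegral.multiset_sum fun μ hμ => ?_
  have hev : Module.End.HasEigenvalue (ρ g) μ := by
    rw [Module.End.hasEigenvalue_iff_isRoot_charpoly]
    exact Polynomial.isRoot_of_mem_roots hμ
  obtain ⟨v, hv⟩ := hev.exists_hasEigenvector
  have h1 := hv.pow_apply (Nat.card G)
  rw [← map_pow, pow_card_eq_one', map_one, Module.End.one_apply] at h1
  have h2 : (μ ^ Nat.card G - 1) • v = 0 := by rw [sub_smul, ← h1, one_smul, sub_self]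
  have h3 : μ ^ Nat.card G = 1 := sub_eq_zero.1 ((smul_eq_zero.1 h2).resolve_right hv.2)
  refine IsIntegral.of_pow Nat.card_pos (n := Nat.card G) ?_
  rw [h3]
  exact isIntegral_one

theorem IsIrreducible.exists_isIntegral_class_sum [Fintype G] [FiniteDimensional ℂ V]
    {ρ : Representation ℂ G V} (h : ρ.IsIrreducible) (s : Finset G)
    (hs : ∀ g x, x ∈ s → g * x * g⁻¹ ∈ s) :
    ∃ c : ℂ, IsIntegral ℤ c ∧ ∀ v, ∑ g ∈ s, ρ g v = c • v := by
  obtain ⟨hV, -⟩ := ρ.isIrreducible_iff_forall.1 h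
  let T : Module.End ℂ V := ∑ g ∈ s, ρ g
  have hTv : ∀ v, T v = ∑ g ∈ s, ρ g v := fun v => by simp [T]
  obtain ⟨c, hc⟩ := h.exists_eq_smul T fun g v => by
    rw [hTv, hTv, map_sum]
    refine Finset.sum_bij' (fun x _ => g⁻¹ * x * g) (fun x _ => g * x * g⁻¹) ?_ ?_ ?_ ?_ ?_
    · intro x hx
      simpa using hs g⁻¹ x hx
    · exact fun x hx => hs g x hx
    · intro x _; group
    · intro x _; group
    · intro x _
      rw [← Module.End.mul_apply, ← Module.End.mul_apply, ← map_mul, ← map_mul]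
      congr 2; group
  refine ⟨c, ?_, fun v => by rw [← hc, hTv]⟩
  have h1 : IsIntegral ℤ (∑ g ∈ s, MonoidAlgebra.of ℤ G g) := IsIntegral.of_finite _ _
  have h2 := h1.map (MonoidAlgebra.lift ℤ (Module.End ℂ V) G ρ)
  have h3 : (MonoidAlgebra.lift ℤ (Module.End ℂ V) G ρ) (∑ g ∈ s, MonoidAlgebra.of ℤ G g)
      = algebraMap ℂ (Module.End ℂ V) c := by
    rw [map_sum]
    simp only [MonoidAlgebra.lift_of]
    ext v
    exact hc v
  rw [h3] at h2
  exact (isIntegral_algebraMap_iff (FaithfulSMul.algebraMap_injective ℂ (Module.End ℂ V))).1 h2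

theorem IsIrreducible.finrank_dvd_card [Finite G] [FiniteDimensional ℂ V]
    {ρ : Representation ℂ G V} (h : ρ.IsIrreducible) : Module.finrank ℂ V ∣ Nat.card G := by
  classical
  have := Fintype.ofFinite G
  obtain ⟨hV, -⟩ := ρ.isIrreducible_iff_forall.1 h
  have key := fun C : ConjClasses G => h.exists_isIntegral_class_sum {g | ConjClasses.mk g = C}
    (fun g x hx => by
      simp only [Finset.mem_filter, Finset.mem_univ, true_and] at hx ⊢
      rw [← hx, ConjClasses.mk_eq_mk_iff_isConj, isConj_comm]
      exact isConj_iff.2 ⟨g, rfl⟩)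
  choose ω hω hωv using key
  have hclass : ∀ g x : G, ConjClasses.mk g = ConjClasses.mk x →
      ρ.character g⁻¹ = ρ.character x⁻¹ := fun g x hgx => by
    obtain ⟨c, rfl⟩ := isConj_iff.1 (ConjClasses.mk_eq_mk_iff_isConj.1 hgx)
    rw [← ρ.char_conj g⁻¹ c]
    congr 1; group
  let χ : ConjClasses G → ℂ := fun C => ρ.character (Quotient.out C)⁻¹
  have hχ : ∀ g, ρ.character g⁻¹ = χ (ConjClasses.mk g) := fun g => by
    refine hclass _ _ ?_
    exact (Quotient.out_eq (ConjClasses.mk g)).symm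
  have hT : ∑ g : G, ρ.character g⁻¹ • ρ g = (∑ C, χ C * ω C) • (1 : Module.End ℂ V) := by
    rw [← Finset.sum_fiberwise (s := Finset.univ) (g := fun g : G => ConjClasses.mk g),
      Finset.sum_smul]
    refine Finset.sum_congr rfl fun C _ => ?_
    ext v
    rw [LinearMap.sum_apply, LinearMap.smul_apply, Module.End.one_apply, mul_smul, ← hωv,
      Finset.smul_sum]
    refine Finset.sum_congr rfl fun g hg => ?_
    rw [LinearMap.smul_apply, hχ, (Finset.mem_filter.1 hg).2]
  have htr := congrArg (LinearMap.trace ℂ V) hT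
  rw [map_sum, map_smul, LinearMap.trace_one] at htr
  have h1 : (Nat.card G : ℂ) = (∑ C, χ C * ω C) * Module.finrank ℂ V := by
    rw [← h.sum_character_mul, ← smul_eq_mul (a := Finset.sum _ _), ← htr]
    refine Finset.sum_congr rfl fun g _ => ?_
    rw [map_smul, smul_eq_mul, mul_comm]
    rfl
  have h2 : IsIntegral ℤ (∑ C, χ C * ω C) :=
    IsIntegral.sum _ fun C _ => (ρ.isIntegral_character _).mul (hω C)
  have hd : (Module.finrank ℂ V : ℂ) ≠ 0 := by
    exact_mod_cast (Module.finrank_pos (R := ℂ) (M := V)).ne'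
  have h3 : (∑ C, χ C * ω C) = algebraMap ℚ ℂ (Nat.card G / Module.finrank ℂ V) := by
    rw [eq_comm, map_div₀]
    simp only [map_natCast]
    rw [div_eq_iff hd, h1]
  rw [h3, isIntegral_algebraMap_iff (algebraMap ℚ ℂ).injective] at h2
  obtain ⟨z, hz⟩ := IsIntegrallyClosed.isIntegral_iff.1 h2
  have h4 : (Nat.card G : ℤ) = Module.finrank ℂ V * z := by
    have hd' : (Module.finrank ℂ V : ℚ) ≠ 0 := by exact_mod_cast hd
    rw [eq_div_iff hd'] at hz
    have : (z : ℚ) * Module.finrank ℂ V = Nat.card G := by simpa using hz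
    rw [mul_comm]
    exact_mod_cast this.symm
  exact_mod_cast (Dvd.intro z h4.symm : (Module.finrank ℂ V : ℤ) ∣ Nat.card G)

end Representation

theorem dvd_card_of_mem_cd {G : Type} [Group G] [Finite G] {x : ℕ} (hx : x ∈ cd G) :
    x ∣ Nat.card G := by
  obtain ⟨V, _, _, _, ρ, h, rfl⟩ := exists_irreducible_of_mem_cd hx
  exact h.finrank_dvd_card

/-- The number of partitions of `n` into parts of size at most `k`. -/
def partitionCount : ℕ → ℕ → ℕ
  | 0, n => if n = 0 then 1 else 0
  | k + 1, n => ∑ j ∈ Finset.range (n / (k + 1) + 1), partitionCount k (n - j * (k + 1))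

theorem exists_finset_card_le_partitionCount (k n : ℕ) :
    ∃ F : Finset (Multiset ℕ), F.card ≤ partitionCount k n ∧
      ∀ s : Multiset ℕ, s.sum = n → (∀ x ∈ s, 0 < x ∧ x ≤ k) → s ∈ F := by
  classical
  induction k generalizing n with
  | zero =>
    have hs0 : ∀ s : Multiset ℕ, (∀ x ∈ s, 0 < x ∧ x ≤ 0) → s = 0 := fun s hs =>
      Multiset.eq_zero_of_forall_notMem fun x hx => by have := hs x hx; omega
    by_cases hn : n = 0
    · exact ⟨{0}, by simp [partitionCount, hn], fun s _ hs => by simp [hs0 s hs]⟩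
    · refine ⟨∅, by simp, fun s hsum hs => absurd hsum ?_⟩
      rw [hs0 s hs]
      exact fun h => hn h.symm
  | succ k ih =>
    choose F hF hmem using ih
    refine ⟨(Finset.range (n / (k + 1) + 1)).biUnion fun j =>
      (F (n - j * (k + 1))).image (Multiset.replicate j (k + 1) + ·), ?_, fun s hsum hs => ?_⟩
    · refine Finset.card_biUnion_le.trans (Finset.sum_le_sum fun j _ => ?_)
      exact Finset.card_image_le.trans (hF _)
    · have hsplit := Multiset.filter_add_not (k + 1 = ·) s
      rw [Multiset.filter_eq] at hsplit
      have hsum' := congrArg Multiset.sum hsplit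
      rw [Multiset.sum_add, Multiset.sum_replicate, hsum, smul_eq_mul] at hsum'
      simp only [Finset.mem_biUnion, Finset.mem_range, Finset.mem_image]
      refine ⟨s.count (k + 1), ?_, _, hmem _ _ ?_ ?_, hsplit⟩
      · rw [Nat.lt_succ_iff, Nat.le_div_iff_mul_le (by omega)]
        omega
      · omega
      · intro x hx
        rw [Multiset.mem_filter] at hx
        have := hs x hx.1
        omega

theorem card_partition_le_partitionCount (n : ℕ) :
    Fintype.card n.Partition ≤ partitionCount n n := by
  classical
  obtain ⟨F, hF, hmem⟩ := exists_finset_card_le_partitionCount n n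
  refine le_trans ?_ hF
  rw [← Finset.card_univ]
  refine Finset.card_le_card_of_injOn (fun p => p.parts) (fun p _ => ?_) ?_
  · exact hmem _ p.parts_sum fun x hx => ⟨p.parts_pos hx, by
      rw [← p.parts_sum]; exact Multiset.le_sum_of_mem hx⟩
  · intro p _ q _ h
    exact Nat.Partition.ext h

theorem card_partition_ten_le : Fintype.card (Nat.Partition 10) ≤ 42 :=
  (card_partition_le_partitionCount 10).trans (by decide +kernel)

theorem card_partition_le_two_pow (n : ℕ) : Fintype.card n.Partition ≤ 2 ^ (n - 1) := by
  classical
  rw [← composition_card]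
  exact Fintype.card_le_of_surjective _ Nat.Partition.ofComposition_surj

theorem card_conjClasses_perm_le (m : ℕ) :
    Nat.card (ConjClasses (Equiv.Perm (Fin m))) ≤ Fintype.card m.Partition := by
  classical
  rw [← Nat.card_eq_fintype_card]
  have hcard : Fintype.card (Fin m) = m := Fintype.card_fin m
  have : Nat.card m.Partition = Nat.card (Fintype.card (Fin m)).Partition := by rw [hcard]
  rw [this]
  refine Nat.card_le_card_of_injective
    (Quotient.lift (fun σ : Equiv.Perm (Fin m) => σ.partition)
      fun σ τ h => Equiv.Perm.partition_eq_of_isConj.1 h) ?_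
  intro a b
  refine Quotient.inductionOn₂ a b fun σ τ h => Quotient.sound ?_
  exact Equiv.Perm.partition_eq_of_isConj.2 h

theorem two_mul_natCard_alternatingGroup_fin {m : ℕ} (hm : 2 ≤ m) :
    2 * Nat.card (alternatingGroup (Fin m)) = m.factorial := by
  have : Nontrivial (Fin m) := Fin.nontrivial_iff_two_le.2 hm
  rw [two_mul_nat_card_alternatingGroup]
  simp [Fintype.card_perm]

theorem card_conjClasses_alternatingGroup_le {m : ℕ} (hm : 2 ≤ m) :
    Nat.card (ConjClasses (alternatingGroup (Fin m))) ≤ 2 * Fintype.card m.Partition := by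
  have : Nontrivial (Fin m) := Fin.nontrivial_iff_two_le.2 hm
  have h := Subgroup.commProb_subgroup_le (H := alternatingGroup (Fin m))
  rw [alternatingGroup.index_eq_two, commProb_def', commProb_def'] at h
  have hA := two_mul_natCard_alternatingGroup_fin hm
  have hS : Nat.card (Equiv.Perm (Fin m)) = m.factorial := by simp [Fintype.card_perm]
  rw [hS, ← hA] at h
  have hpos : (0 : ℚ) < Nat.card (alternatingGroup (Fin m)) := by exact_mod_cast Nat.card_pos
  have h1 := card_conjClasses_perm_le m
  have h2 : (Nat.card (ConjClasses (alternatingGroup (Fin m))) : ℚ) ≤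
      2 * Nat.card (ConjClasses (Equiv.Perm (Fin m))) := by
    rw [div_le_iff₀ hpos] at h
    refine h.trans (le_of_eq ?_)
    push_cast
    field_simp
  have h3 : Nat.card (ConjClasses (alternatingGroup (Fin m))) ≤
      2 * Nat.card (ConjClasses (Equiv.Perm (Fin m))) := by exact_mod_cast h2
  omega

theorem factorial_le_of_cd_subset {m n : ℕ} (hm : 2 ≤ m)
    (h : cd (alternatingGroup (Fin m)) ⊆ cd (Equiv.Perm (Fin n))) :
    m.factorial ≤ 4 * Fintype.card m.Partition * n.factorial := by
  have hS : Nat.card (Equiv.Perm (Fin n)) = n.factorial := by simp [Fintype.card_perm]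
  have h1 := card_le_of_forall_mem_cd (G := alternatingGroup (Fin m)) (B := n.factorial)
    fun x hx => hS ▸ sq_le_card_of_mem_cd (h hx)
  have h2 := card_conjClasses_alternatingGroup_le hm
  rw [← two_mul_natCard_alternatingGroup_fin hm]
  calc _ ≤ 2 * (Nat.card (ConjClasses (alternatingGroup (Fin m))) * n.factorial) := by gcongr
    _ ≤ 2 * (2 * Fintype.card m.Partition * n.factorial) := by gcongr
    _ = _ := by ring

theorem two_pow_mul_factorial_lt_of_nine_le {n : ℕ} (hn : 9 ≤ n) :
    2 ^ (2 * n - 5 + 1) * n.factorial < (2 * n - 5).factorial := by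
  induction n, hn using Nat.le_induction with
  | base => decide
  | succ n hn ih =>
    obtain ⟨k, rfl⟩ := Nat.exists_eq_add_of_le hn
    have e1 : 2 * (9 + k + 1) - 5 = 13 + 2 * k + 2 := by omega
    have e2 : 2 * (9 + k) - 5 = 13 + 2 * k := by omega
    rw [e1, Nat.factorial_succ (9 + k), Nat.factorial_succ (13 + 2 * k + 1),
      Nat.factorial_succ (13 + 2 * k)]
    rw [e2] at ih
    have : 4 * (9 + k + 1) ≤ (13 + 2 * k + 1 + 1) * (13 + 2 * k + 1) := by nlinarith
    calc 2 ^ (13 + 2 * k + 2 + 1) * ((9 + k + 1) * (9 + k).factorial)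
        = 4 * (9 + k + 1) * (2 ^ (13 + 2 * k + 1) * (9 + k).factorial) := by ring
      _ < 4 * (9 + k + 1) * (13 + 2 * k).factorial := by gcongr
      _ ≤ (13 + 2 * k + 1 + 1) * (13 + 2 * k + 1) * (13 + 2 * k).factorial := by gcongr
      _ = _ := by ring

theorem two_pow_mul_factorial_lt_of_le {n m₀ m : ℕ} (hm : m₀ ≤ m)
    (h : 2 ^ (m₀ + 1) * n.factorial < m₀.factorial) (hm₀ : 1 ≤ m₀) :
    2 ^ (m + 1) * n.factorial < m.factorial := by
  induction m, hm using Nat.le_induction with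
  | base => exact h
  | succ m hm ih =>
    rw [Nat.factorial_succ]
    calc 2 ^ (m + 1 + 1) * n.factorial = 2 * (2 ^ (m + 1) * n.factorial) := by ring
      _ < 2 * m.factorial := by gcongr
      _ ≤ (m + 1) * m.factorial := by gcongr; omega

theorem not_cd_subset_of_two_pow_mul_factorial_lt {m n : ℕ} (hm : 2 ≤ m)
    (h : 2 ^ (m + 1) * n.factorial < m.factorial) :
    ¬ cd (alternatingGroup (Fin m)) ⊆ cd (Equiv.Perm (Fin n)) := fun hcd => by
  have h1 := factorial_le_of_cd_subset hm hcd
  have h2 := card_partition_le_two_pow m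
  have h3 : 4 * 2 ^ (m - 1) = 2 ^ (m + 1) := by
    obtain ⟨k, rfl⟩ := Nat.exists_eq_add_of_le' (show 1 ≤ m by omega)
    simp only [Nat.add_sub_cancel]; ring
  have h4 : 4 * Fintype.card m.Partition * n.factorial ≤ 2 ^ (m + 1) * n.factorial := by
    rw [← h3]; gcongr
  omega

namespace Representation

variable {G V : Type} [Group G] [AddCommGroup V] [Module ℂ V]

/-- If `ℓ` is a functional fixed by `K`, with no nonzero vector killed by all translates of `ℓ`,
and such that no nonzero `K`-fixed vector is killed by `ℓ`, then the representation is
irreducible. -/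
theorem isIrreducible_of_subgroup [Finite G] [Nontrivial V] (ρ : Representation ℂ G V)
    (K : Subgroup G) (ℓ : V →ₗ[ℂ] ℂ) (hK : ∀ k ∈ K, ∀ v, ℓ (ρ k v) = ℓ v)
    (hℓ : ∀ v, (∀ g, ℓ (ρ g v) = 0) → v = 0)
    (hfix : ∀ v, (∀ k ∈ K, ρ k v = v) → ℓ v = 0 → v = 0) : ρ.IsIrreducible := by
  classical
  have := Fintype.ofFinite G
  have key : ∀ W : Submodule ℂ V, (∀ g, ∀ w ∈ W, ρ g w ∈ W) → W ≠ ⊥ →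
      ∃ w ∈ W, (∀ k ∈ K, ρ k w = w) ∧ ℓ w ≠ 0 := by
    intro W hW hW0
    obtain ⟨w, hw, hw0⟩ := Submodule.exists_mem_ne_zero_of_ne_bot hW0
    obtain ⟨g, hg⟩ : ∃ g, ℓ (ρ g w) ≠ 0 := by
      by_contra! h
      exact hw0 (hℓ w h)
    refine ⟨∑ k : K, ρ k (ρ g w), ?_, ?_, ?_⟩
    · exact W.sum_mem fun k _ => hW _ _ (hW _ _ hw)
    · intro k hk
      rw [map_sum]
      refine Fintype.sum_equiv (Equiv.mulLeft (⟨k, hk⟩ : K)) _ _ fun x => ?_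
      simp [map_mul]
    · rw [map_sum, Finset.sum_congr rfl fun (k : K) _ => hK k k.2 (ρ g w)]
      simpa using hg
  rw [isIrreducible_iff_forall]
  refine ⟨inferInstance, fun W hW => ?_⟩
  obtain ⟨W', hc, hW'⟩ := ρ.exists_isCompl_of_invariant W hW
  by_contra! h
  have hW'0 : W' ≠ ⊥ := fun h0 => h.2 (by simpa [h0] using hc.sup_eq_top)
  obtain ⟨w, hw, hwK, hwℓ⟩ := key W hW h.1
  obtain ⟨w', hw', hwK', hwℓ'⟩ := key W' hW' hW'0
  have h1 : ℓ w' • w - ℓ w • w' = 0 := by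
    refine hfix _ (fun k hk => ?_) ?_
    · rw [map_sub, map_smul, map_smul, hwK k hk, hwK' k hk]
    · simp [mul_comm]
  have h2 : ℓ w' • w ∈ W ⊓ W' :=
    ⟨W.smul_mem _ hw, by rw [sub_eq_zero.1 h1]; exact W'.smul_mem _ hw'⟩
  rw [hc.inf_eq_bot, Submodule.mem_bot, smul_eq_zero] at h2
  rcases h2 with h2 | h2
  · exact hwℓ' h2
  · exact hwℓ (by rw [h2, map_zero])

/-- The permutation representation on functions attached to an action by permutations. -/
def funRep {X : Type} (φ : G →* Equiv.Perm X) : Representation ℂ G (X → ℂ) where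
  toFun g := LinearMap.funLeft ℂ ℂ (φ g⁻¹)
  map_one' := by ext; simp [LinearMap.funLeft]
  map_mul' g h := by ext; simp [LinearMap.funLeft]

theorem funRep_apply {X : Type} (φ : G →* Equiv.Perm X) (g : G) (f : X → ℂ) (x : X) :
    funRep φ g f x = f (φ g⁻¹ x) := rfl

/-- The representation on an invariant subspace. -/
def restrictTo (ρ : Representation ℂ G V) (W : Submodule ℂ V) (hW : ∀ g, ∀ w ∈ W, ρ g w ∈ W) :
    Representation ℂ G W :=
  Subrepresentation.toRepresentation ⟨W, fun g w hw => hW g w hw⟩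

end Representation

theorem alternatingGroup.exists_forall_apply_eq {m k : ℕ} (hk : k + 2 ≤ m) {x y : Fin k → Fin m}
    (hx : Function.Injective x) (hy : Function.Injective y) :
    ∃ g : alternatingGroup (Fin m), ∀ i, (g : Equiv.Perm (Fin m)) (x i) = y i := by
  have h1 := alternatingGroup.isMultiplyPretransitive (Fin m)
  have h2 : MulAction.IsMultiplyPretransitive (alternatingGroup (Fin m)) (Fin m) k :=
    MulAction.isMultiplyPretransitive_of_le (n := Nat.card (Fin m) - 2)
      (by rw [Nat.card_fin]; omega) (by omega)
  obtain ⟨g, hg⟩ := h2.exists_smul_eq ⟨x, hx⟩ ⟨y, hy⟩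
  refine ⟨g, fun i => ?_⟩
  exact congrArg (fun e : Fin k ↪ Fin m => e i) hg

theorem sub_one_mem_cd_alternatingGroup {m : ℕ} (hm : 4 ≤ m) :
    m - 1 ∈ cd (alternatingGroup (Fin m)) := by
  have : NeZero m := ⟨by omega⟩
  let A := alternatingGroup (Fin m)
  let ρ : Representation ℂ A (Fin m → ℂ) := Representation.funRep A.subtype
  let S : (Fin m → ℂ) →ₗ[ℂ] ℂ := ∑ i, LinearMap.proj i
  have hS : ∀ f, S f = ∑ i, f i := fun f => by simp [S]
  have hinv : ∀ g, ∀ f ∈ LinearMap.ker S, ρ g f ∈ LinearMap.ker S := fun g f hf => by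
    rw [LinearMap.mem_ker, hS] at hf ⊢
    rw [← hf]
    exact Equiv.sum_comp (A.subtype g⁻¹) f
  have hdim : Module.finrank ℂ (LinearMap.ker S) = m - 1 := by
    have h1 := S.finrank_range_add_finrank_ker
    have h2 : LinearMap.range S = ⊤ := LinearMap.range_eq_top.2 fun c =>
      ⟨Pi.single 0 c, by simp [hS]⟩
    rw [h2, finrank_top, Module.finrank_self, Module.finrank_fin_fun] at h1
    omega
  rw [← hdim]
  have : Nontrivial (LinearMap.ker S) := Module.nontrivial_of_finrank_pos (R := ℂ) (by omega)
  refine finrank_mem_cd (ρ := ρ.restrictTo _ hinv) (Representation.isIrreducible_of_subgroup _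
    ((MulAction.stabilizer (Equiv.Perm (Fin m)) (0 : Fin m)).comap A.subtype)
    ((LinearMap.proj 0).comp (LinearMap.ker S).subtype) ?_ ?_ ?_)
  · intro k hk v
    have : (k : Equiv.Perm (Fin m))⁻¹ 0 = 0 := Equiv.Perm.inv_eq_iff_eq.2 (Eq.symm hk)
    exact congrArg (v : Fin m → ℂ) this
  · intro v hv
    ext x
    obtain ⟨g, hg⟩ := alternatingGroup.exists_forall_apply_eq (k := 1) (by omega)
      (x := ![x]) (y := ![0]) (Function.injective_of_subsingleton _)
      (Function.injective_of_subsingleton _)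
    have h1 : (g : Equiv.Perm (Fin m))⁻¹ 0 = x := Equiv.Perm.inv_eq_iff_eq.2 (hg 0).symm
    have h2 : (v : Fin m → ℂ) ((g : Equiv.Perm (Fin m))⁻¹ 0) = 0 := hv g
    rwa [h1] at h2
  · rintro ⟨v, hv⟩ hfix h0
    have h0 : v 0 = 0 := h0
    have hconst : ∀ x y, x ≠ 0 → y ≠ 0 → v x = v y := by
      intro x y hx hy
      obtain ⟨g, hg⟩ := alternatingGroup.exists_forall_apply_eq (k := 2) (by omega)
        (x := ![0, y]) (y := ![0, x])
        (by intro i j; fin_cases i <;> fin_cases j <;> simp [hy, hy.symm])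
        (by intro i j; fin_cases i <;> fin_cases j <;> simp [hx, hx.symm])
      have h1 : (g : Equiv.Perm (Fin m))⁻¹ x = y := Equiv.Perm.inv_eq_iff_eq.2 (hg 1).symm
      have h2 := congrArg (fun w : LinearMap.ker S => (w : Fin m → ℂ) x) (hfix g (hg 0))
      have h3 : v ((g : Equiv.Perm (Fin m))⁻¹ x) = v x := h2
      rw [← h3, h1]
    rw [LinearMap.mem_ker, hS, ← Finset.add_sum_erase _ _ (Finset.mem_univ 0), h0, zero_add] at hv
    ext x
    by_cases hx : x = 0
    · rw [hx]; exact h0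
    · rw [Finset.sum_congr rfl fun y hy => hconst y x (Finset.ne_of_mem_erase hy) hx,
        Finset.sum_const, Finset.card_erase_of_mem (Finset.mem_univ _), Finset.card_univ,
        Fintype.card_fin, smul_eq_zero] at hv
      exact hv.resolve_left (by omega)

/-- The action on unordered pairs. -/
def sym2Hom (α : Type) : Equiv.Perm α →* Equiv.Perm (Sym2 α) where
  toFun g :=
    { toFun := Sym2.map g
      invFun := Sym2.map g.symm
      left_inv := fun z => by induction z; simp
      right_inv := fun z => by induction z; simp }
  map_one' := by ext z; induction z; simp
  map_mul' g h := by ext z; induction z; simp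

theorem sym2Hom_apply {α : Type} (g : Equiv.Perm α) (x y : α) :
    sym2Hom α g s(x, y) = s(g x, g y) := rfl

/-- The diagonal values and the row sums of a symmetric function of two variables. -/
noncomputable def diagRowSum (m : ℕ) :
    (Sym2 (Fin m) → ℂ) →ₗ[ℂ] (Fin m → ℂ) × (Fin m → ℂ) where
  toFun f := (fun i => f s(i, i), fun i => ∑ j, f s(i, j))
  map_add' f g := by ext <;> simp [Finset.sum_add_distrib]
  map_smul' c f := by ext <;> simp [Finset.mul_sum]

theorem diagRowSum_surjective {m : ℕ} (hm : 3 ≤ m) : Function.Surjective (diagRowSum m) := by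
  rintro ⟨d, r⟩
  let a : ℂ := 1 / (m - 2)
  let b : ℂ := -a / (m - 1)
  let g : Fin m → ℂ := r - d
  let S : ℂ := ∑ i, g i
  let e : Fin m → ℂ := fun i => d i - 2 * a * g i - b * S
  refine ⟨Sym2.lift ⟨fun i j => a * (g i + g j) + b * S + if i = j then e i else 0, ?_⟩, ?_⟩
  · intro i j
    by_cases h : i = j
    · subst h; rfl
    · simp [h, Ne.symm h, add_comm (g i)]
  · have h2 : (m : ℂ) - 2 ≠ 0 := by
      rw [sub_ne_zero]; exact_mod_cast (show m ≠ 2 by omega)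
    have h1 : (m : ℂ) - 1 ≠ 0 := by
      rw [sub_ne_zero]; exact_mod_cast (show m ≠ 1 by omega)
    have hb : b * (m - 1) = -a := div_mul_cancel₀ _ h1
    have ha : a * (m - 2) = 1 := div_mul_cancel₀ _ h2
    ext i
    · simp [diagRowSum, e]; ring
    · simp only [diagRowSum, LinearMap.coe_mk, AddHom.coe_mk, Sym2.lift_mk,
        Finset.sum_add_distrib, ← Finset.mul_sum, Finset.sum_const, Finset.card_univ,
        Fintype.card_fin, Finset.sum_ite_eq, Finset.mem_univ, if_true, nsmul_eq_mul]
      have hS : ∑ j, g j = S := rfl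
      have hg : g i = r i - d i := rfl
      rw [hS]
      simp only [e]
      linear_combination S * hb + g i * ha + hg

theorem finrank_ker_diagRowSum {m : ℕ} (hm : 3 ≤ m) :
    Module.finrank ℂ (LinearMap.ker (diagRowSum m)) = m * (m - 3) / 2 := by
  have h1 := (diagRowSum m).finrank_range_add_finrank_ker
  rw [LinearMap.range_eq_top.2 (diagRowSum_surjective hm), finrank_top, Module.finrank_prod,
    Module.finrank_fin_fun, Module.finrank_fintype_fun_eq_card, Sym2.card, Fintype.card_fin,
    Nat.choose_two_right] at h1
  obtain ⟨k, rfl⟩ := Nat.exists_eq_add_of_le' hm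
  simp only [Nat.add_sub_cancel] at h1 ⊢
  have h2 : (k + 3 + 1) * (k + 3) = (k + 3) * k + 2 * (k + 3 + (k + 3)) := by ring
  rw [h2, Nat.add_mul_div_left _ _ (by norm_num)] at h1
  omega

theorem injective_vecFour {α : Type} {a b c d : α} (hab : a ≠ b) (hac : a ≠ c) (had : a ≠ d)
    (hbc : b ≠ c) (hbd : b ≠ d) (hcd : c ≠ d) : Function.Injective ![a, b, c, d] := by
  intro i j
  fin_cases i <;> fin_cases j <;>
    simp [hab, hac, had, hbc, hbd, hcd, hab.symm, hac.symm, had.symm, hbc.symm, hbd.symm, hcd.symm]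

theorem mul_sub_three_div_two_mem_cd_alternatingGroup {m : ℕ} (hm : 6 ≤ m) :
    m * (m - 3) / 2 ∈ cd (alternatingGroup (Fin m)) := by
  let A := alternatingGroup (Fin m)
  let ρ : Representation ℂ A (Sym2 (Fin m) → ℂ) :=
    Representation.funRep ((sym2Hom (Fin m)).comp A.subtype)
  have hρ : ∀ (g : A) (f : Sym2 (Fin m) → ℂ) (x y : Fin m),
      ρ g f s((g : Equiv.Perm (Fin m)) x, (g : Equiv.Perm (Fin m)) y) = f s(x, y) := by
    intro g f x y
    rw [Representation.funRep_apply, MonoidHom.comp_apply, sym2Hom_apply]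
    simp
  set U := LinearMap.ker (diagRowSum m) with hU
  have hmem : ∀ f, f ∈ U ↔ (∀ i, f s(i, i) = 0) ∧ ∀ i, ∑ j, f s(i, j) = 0 := fun f => by
    rw [hU, LinearMap.mem_ker, Prod.ext_iff, funext_iff, funext_iff]
    rfl
  have hinv : ∀ g, ∀ f ∈ U, ρ g f ∈ U := fun g f hf => by
    rw [hmem] at hf ⊢
    refine ⟨fun i => ?_, fun i => ?_⟩
    · obtain ⟨j, rfl⟩ := (g : Equiv.Perm (Fin m)).surjective i
      rw [hρ, hf.1]
    · obtain ⟨j, rfl⟩ := (g : Equiv.Perm (Fin m)).surjective i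
      rw [← Equiv.sum_comp (g : Equiv.Perm (Fin m))]
      simp only [hρ, hf.2]
  have hdim : Module.finrank ℂ U = m * (m - 3) / 2 := finrank_ker_diagRowSum (by omega)
  rw [← hdim]
  have hpos : 0 < m * (m - 3) / 2 := by
    have : 6 * 3 ≤ m * (m - 3) := Nat.mul_le_mul hm (by omega)
    omega
  have : Nontrivial U := Module.nontrivial_of_finrank_pos (R := ℂ) (by omega)
  obtain ⟨a, b, hab⟩ : ∃ a b : Fin m, a ≠ b := ⟨⟨0, by omega⟩, ⟨1, by omega⟩, by simp⟩
  refine finrank_mem_cd (ρ := ρ.restrictTo _ hinv) (Representation.isIrreducible_of_subgroup _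
    ((MulAction.stabilizer (Equiv.Perm (Fin m)) a ⊓
      MulAction.stabilizer (Equiv.Perm (Fin m)) b).comap A.subtype)
    ((LinearMap.proj s(a, b)).comp U.subtype) ?_ ?_ ?_)
  · rintro k ⟨hka, hkb⟩ v
    have hka : (k : Equiv.Perm (Fin m)) a = a := hka
    have hkb : (k : Equiv.Perm (Fin m)) b = b := hkb
    have := hρ k v a b
    rw [hka, hkb] at this
    exact this
  · rintro ⟨v, hv⟩ h
    have hv' := (hmem v).1 hv
    ext z
    induction z with | _ x y
    by_cases hxy : x = y
    · subst hxy; exact hv'.1 x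
    obtain ⟨g, hg⟩ := alternatingGroup.exists_forall_apply_eq (k := 2) (by omega)
      (x := ![x, y]) (y := ![a, b])
      (by intro i j; fin_cases i <;> fin_cases j <;> simp [hxy, Ne.symm hxy])
      (by intro i j; fin_cases i <;> fin_cases j <;> simp [hab, hab.symm])
    have h0 : (g : Equiv.Perm (Fin m)) x = a := hg 0
    have h1 : (g : Equiv.Perm (Fin m)) y = b := hg 1
    have h2 := hρ g v x y
    rw [h0, h1] at h2
    exact h2.symm.trans (h g)
  · rintro ⟨v, hv⟩ hfix h0
    have h0 : v s(a, b) = 0 := h0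
    have hv' := (hmem v).1 hv
    have hinvt : ∀ g : A, (g : Equiv.Perm (Fin m)) a = a → (g : Equiv.Perm (Fin m)) b = b →
        ∀ x y, v s((g : Equiv.Perm (Fin m)) x, (g : Equiv.Perm (Fin m)) y) = v s(x, y) := by
      intro g ha hb x y
      have := congrArg (fun w : U => (w : Sym2 (Fin m) → ℂ)
        s((g : Equiv.Perm (Fin m)) x, (g : Equiv.Perm (Fin m)) y)) (hfix g ⟨ha, hb⟩)
      exact this.symm.trans (hρ g v x y)
    have hmove : ∀ x y x' y', x ≠ y → x' ≠ y' → x ≠ a → x ≠ b → y ≠ a → y ≠ b → x' ≠ a →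
        x' ≠ b → y' ≠ a → y' ≠ b → v s(x, y) = v s(x', y') ∧ v s(a, x) = v s(a, x') ∧
          v s(b, x) = v s(b, x') := by
      intro x y x' y' hxy hxy' hxa hxb hya hyb hxa' hxb' hya' hyb'
      obtain ⟨g, hg⟩ := alternatingGroup.exists_forall_apply_eq (k := 4) (by omega)
        (x := ![a, b, x, y]) (y := ![a, b, x', y'])
        (injective_vecFour hab hxa.symm hya.symm hxb.symm hyb.symm hxy)
        (injective_vecFour hab hxa'.symm hya'.symm hxb'.symm hyb'.symm hxy')
      have ha : (g : Equiv.Perm (Fin m)) a = a := hg 0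
      have hb : (g : Equiv.Perm (Fin m)) b = b := hg 1
      have hx : (g : Equiv.Perm (Fin m)) x = x' := hg 2
      have hy : (g : Equiv.Perm (Fin m)) y = y' := hg 3
      have h1 := hinvt g ha hb
      refine ⟨?_, ?_, ?_⟩
      · rw [← hx, ← hy, h1]
      · rw [← h1 a x, ha, hx]
      · rw [← h1 b x, hb, hx]
    have hother : ∀ x : Fin m, ∃ y, y ≠ x ∧ y ≠ a ∧ y ≠ b := by
      intro x
      have : ({x, a, b} : Finset (Fin m)).card < Fintype.card (Fin m) := by
        rw [Fintype.card_fin]; exact Finset.card_le_three.trans_lt (by omega)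
      obtain ⟨y, hy⟩ := Finset.exists_mem_notMem_of_card_lt_card (t := Finset.univ) this
      exact ⟨y, by simpa using hy⟩
    have hsplit : ∀ f : Fin m → ℂ, ∑ j, f j = f a + (f b + ∑ j ∈ (Finset.univ.erase a).erase b, f j)
        := fun f => by
      rw [Finset.add_sum_erase _ _ (Finset.mem_erase.2 ⟨hab.symm, Finset.mem_univ b⟩),
        Finset.add_sum_erase _ _ (Finset.mem_univ a)]
    have hcard : ((Finset.univ.erase a).erase b).card = m - 2 := by
      rw [Finset.card_erase_of_mem (Finset.mem_erase.2 ⟨hab.symm, Finset.mem_univ b⟩),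
        Finset.card_erase_of_mem (Finset.mem_univ a), Finset.card_univ, Fintype.card_fin]
      omega
    have hm2 : m - 2 ≠ 0 := by omega
    have hrow : ∀ x, x ≠ a → x ≠ b → v s(a, x) = 0 ∧ v s(b, x) = 0 := by
      intro x hxa hxb
      obtain ⟨y, hyx, hya, hyb⟩ := hother x
      have hcst : ∀ j ∈ (Finset.univ.erase a).erase b,
          v s(a, j) = v s(a, x) ∧ v s(b, j) = v s(b, x) := by
        intro j hj
        have hjb := (Finset.mem_erase.1 hj).1
        have hja := (Finset.mem_erase.1 (Finset.mem_erase.1 hj).2).1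
        obtain ⟨z, hzj, hza, hzb⟩ := hother j
        exact (hmove j z x y hzj.symm hyx.symm hja hjb hza hzb hxa hxb hya hyb).2
      have ha := hv'.2 a
      have hb := hv'.2 b
      rw [hsplit, hv'.1, h0, Finset.sum_congr rfl fun j hj => (hcst j hj).1] at ha
      rw [hsplit, hv'.1, Sym2.eq_swap, h0, Finset.sum_congr rfl fun j hj => (hcst j hj).2] at hb
      simpa [hcard, hm2] using And.intro ha hb
    have hrest : ∀ x y, x ≠ a → x ≠ b → y ≠ a → y ≠ b → x ≠ y → v s(x, y) = 0 := by
      intro x y hxa hxb hya hyb hxy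
      have hx := hv'.2 x
      have hxmem : x ∈ (Finset.univ.erase a).erase b := by simp [hxa, hxb]
      rw [hsplit, Sym2.eq_swap, (hrow x hxa hxb).1, Sym2.eq_swap, (hrow x hxa hxb).2,
        ← Finset.add_sum_erase _ _ hxmem, hv'.1, Finset.sum_congr rfl fun j hj =>
          (hmove x j x y (Finset.ne_of_mem_erase hj).symm hxy hxa hxb
            (Finset.mem_erase.1 (Finset.mem_erase.1 (Finset.mem_erase.1 hj).2).2).1
            (Finset.mem_erase.1 (Finset.mem_erase.1 hj).2).1 hxa hxb hya hyb).1] at hx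
      have hm3 : m - 2 - 1 ≠ 0 := by omega
      simpa [Finset.card_erase_of_mem hxmem, hcard, hm3] using hx
    ext z
    induction z with | _ x y
    change v s(x, y) = 0
    by_cases hxy : x = y
    · subst hxy; exact hv'.1 x
    by_cases hxa : x = a
    · subst hxa
      by_cases hyb : y = b
      · subst hyb; exact h0
      · exact (hrow y (Ne.symm hxy) hyb).1
    by_cases hxb : x = b
    · subst hxb
      by_cases hya : y = a
      · subst hya; rw [Sym2.eq_swap]; exact h0
      · exact (hrow y hya (Ne.symm hxy)).2
    by_cases hya : y = a
    · subst hya; rw [Sym2.eq_swap]; exact (hrow x hxa hxb).1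
    by_cases hyb : y = b
    · subst hyb; rw [Sym2.eq_swap]; exact (hrow x hxa hxb).2
    exact hrest x y hxa hxb hya hyb hxy

section PairFunctions

variable {α V : Type} [Fintype α] [DecidableEq α] [AddCommGroup V] [Module ℂ V]

theorem exists_ne_ne_ne (hα : 4 ≤ Fintype.card α) (a b c : α) : ∃ x, x ≠ a ∧ x ≠ b ∧ x ≠ c := by
  have : ({a, b, c} : Finset α).card < Fintype.card α := Finset.card_le_three.trans_lt hα
  obtain ⟨x, hx⟩ := Finset.exists_mem_notMem_of_card_lt_card (t := Finset.univ) this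
  exact ⟨x, by simpa using hx⟩

/-- A function on ordered pairs with vanishing row sums, (anti)symmetric, whose mixed second
differences satisfy a relation, vanishes. -/
theorem pair_function_eq_zero (hα : 5 ≤ Fintype.card α) (f : α → α → V) {ε s : ℂ}
    (hε : ε = 1 ∨ ε = -1) (hs : s = 1 ∨ s = -1) (hdiag : ∀ i, f i i = 0)
    (hsymm : ∀ i j, f j i = ε • f i j) (hrow : ∀ i, ∑ j, f i j = 0)
    (hrel : ∀ i j a b, i ≠ j → a ≠ b → i ≠ a → i ≠ b → j ≠ a → j ≠ b →
      f i a - f i b + s • (f j a - f j b) = 0) (i j : α) : f i j = 0 := by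
  have hsplit : ∀ (g : α → V) (i j : α), i ≠ j →
      ∑ b, g b = g i + (g j + ∑ b ∈ (Finset.univ.erase i).erase j, g b) := fun g i j hij => by
    rw [Finset.add_sum_erase _ _ (Finset.mem_erase.2 ⟨hij.symm, Finset.mem_univ j⟩),
      Finset.add_sum_erase _ _ (Finset.mem_univ i)]
  obtain ⟨k, hk⟩ := Nat.exists_eq_add_of_le' hα
  have hcard : ∀ i j : α, i ≠ j → ((Finset.univ.erase i).erase j).card = k + 3 := fun i j hij => by
    rw [Finset.card_erase_of_mem (Finset.mem_erase.2 ⟨hij.symm, Finset.mem_univ j⟩),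
      Finset.card_erase_of_mem (Finset.mem_univ i), Finset.card_univ]
    omega
  have hmain : ∀ i j a, i ≠ j → i ≠ a → j ≠ a →
      ((k : ℂ) + 3) • (f i a + s • f j a) = -(1 + s * ε) • f i j := by
    intro i j a hij hia hja
    have hconst : ∀ b ∈ (Finset.univ.erase i).erase j, f i b + s • f j b = f i a + s • f j a := by
      intro b hb
      have hjb := (Finset.mem_erase.1 hb).1
      have hib := (Finset.mem_erase.1 (Finset.mem_erase.1 hb).2).1
      by_cases hab : a = b
      · rw [hab]
      · linear_combination (norm := module) -hrel i j a b hij hab hia hib.symm hja hjb.symm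
    have h1 : ∑ b, (f i b + s • f j b) = 0 := by
      rw [Finset.sum_add_distrib, ← Finset.smul_sum, hrow, hrow, smul_zero, add_zero]
    rw [hsplit _ i j hij, Finset.sum_congr rfl hconst, Finset.sum_const, hcard i j hij, hdiag,
      hdiag, hsymm i j, ← Nat.cast_smul_eq_nsmul ℂ] at h1
    push_cast at h1
    linear_combination (norm := module) h1
  by_cases hij : i = j
  · rw [hij, hdiag]
  have hk0 : (k : ℂ) + 3 ≠ 0 := by exact_mod_cast (show k + 3 ≠ 0 by omega)
  have hk1 : (k : ℂ) + 1 ≠ 0 := by exact_mod_cast (show k + 1 ≠ 0 by omega)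
  have hk2 : (k : ℂ) + 2 ≠ 0 := by exact_mod_cast (show k + 2 ≠ 0 by omega)
  have hk4 : (k : ℂ) + 4 ≠ 0 := by exact_mod_cast (show k + 4 ≠ 0 by omega)
  have hk5 : (k : ℂ) + 5 ≠ 0 := by exact_mod_cast (show k + 5 ≠ 0 by omega)
  have cancel : ∀ {c : ℂ} {x : V}, c ≠ 0 → c • x = 0 → x = 0 := fun hc h =>
    (smul_eq_zero.1 h).resolve_left hc
  obtain ⟨a, hai, haj, -⟩ := exists_ne_ne_ne (by omega) i j j
  have e1 := hmain i j a hij hai.symm haj.symm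
  have e2 := hmain i a j hai.symm hij haj
  have e3 := hmain j a i haj.symm (Ne.symm hij) hai
  have s1 := hsymm i j
  have s2 := hsymm i a
  have s3 := hsymm j a
  rcases hs with rfl | rfl <;> rcases hε with rfl | rfl
  · rw [s3] at e2
    have h1 : f i a = f i j := sub_eq_zero.1 (cancel hk1 (by
      linear_combination (norm := module) e1 - e2))
    have h2 : f j a = f i j := by
      rw [s1, s2] at e3
      exact sub_eq_zero.1 (cancel hk1 (by
        rw [h1] at e1 e3
        linear_combination (norm := module) e1 - e3))
    rw [h1, h2] at e1
    exact cancel hk4 (by linear_combination (norm := module) (1 / 2 : ℂ) • e1)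
  · obtain ⟨b, hbi, hbj, hba⟩ := exists_ne_ne_ne (by omega) i j a
    have hz : ∀ x y z : α, x ≠ y → x ≠ z → y ≠ z → f x z = - f y z := fun x y z hxy hxz hyz =>
      sub_eq_zero.1 (cancel hk0 (by
        linear_combination (norm := module) hmain x y z hxy hxz hyz))
    have h1 := hz i a j hai.symm hij haj
    have h2 := hz a b j hba.symm haj hbj
    have h3 := hz b i j hbi hbj hij
    exact cancel (two_ne_zero (α := ℂ)) (by
      linear_combination (norm := module) h1 - h2 + h3)
  · have hz : ∀ x y z : α, x ≠ y → x ≠ z → y ≠ z → f x z = f y z := fun x y z hxy hxz hyz =>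
      sub_eq_zero.1 (cancel hk0 (by
        linear_combination (norm := module) hmain x y z hxy hxz hyz))
    have h1 : ∀ b ∈ Finset.univ.erase i, f i b = f i j := fun b hb => by
      have hbi := Finset.ne_of_mem_erase hb
      by_cases hbj : b = j
      · rw [hbj]
      · rw [hsymm b i, hz b j i hbj hbi (Ne.symm hij), hsymm i j]
        simp
    have h2 := hrow i
    rw [← Finset.add_sum_erase _ _ (Finset.mem_univ i), hdiag, zero_add, Finset.sum_congr rfl h1,
      Finset.sum_const, ← Nat.cast_smul_eq_nsmul ℂ, Finset.card_erase_of_mem (Finset.mem_univ i),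
      Finset.card_univ, hk] at h2
    exact cancel (by rw [Nat.cast_ne_zero]; omega) h2
  · rw [s3] at e2
    rw [s1, s2] at e3
    have h1 : f j a = f i j := sub_eq_zero.1 (cancel hk5 (by
      linear_combination (norm := module) e3 - e1))
    rw [h1] at e1 e2
    exact cancel (mul_ne_zero hk5 hk2) (by
      linear_combination (norm := module) (((k : ℂ) + 3) / 2) • e2 - e1)

end PairFunctions

theorem Equiv.Perm.exists_forall_apply_eq {α : Type} {k : ℕ} {x y : Fin k → α}
    (hx : Function.Injective x) (hy : Function.Injective y) :
    ∃ g : Equiv.Perm α, ∀ i, g (x i) = y i := by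
  have h2 := Equiv.Perm.isMultiplyPretransitive α k
  obtain ⟨g, hg⟩ := h2.exists_smul_eq ⟨x, hx⟩ ⟨y, hy⟩
  exact ⟨g, fun i => congrArg (fun e : Fin k ↪ α => e i) hg⟩

theorem Equiv.Perm.exists_apply_eq_apply_eq {α : Type} {a b c d : α} (hab : a ≠ b) (hcd : c ≠ d) :
    ∃ g : Equiv.Perm α, g a = c ∧ g b = d := by
  obtain ⟨g, hg⟩ := Equiv.Perm.exists_forall_apply_eq (x := ![a, b]) (y := ![c, d])
    (by intro i j; fin_cases i <;> fin_cases j <;> simp [hab, hab.symm])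
    (by intro i j; fin_cases i <;> fin_cases j <;> simp [hcd, hcd.symm])
  exact ⟨g, hg 0, hg 1⟩

namespace Representation

variable {α V : Type} [Fintype α] [DecidableEq α] [AddCommGroup V] [Module ℂ V]
  {ρ : Representation ℂ (Equiv.Perm α) V}

theorem IsIrreducible.eq_top_of_mem {G : Type} [Group G] {ρ : Representation ℂ G V}
    (h : ρ.IsIrreducible) (W : Submodule ℂ V) (hW : ∀ g, ∀ w ∈ W, ρ g w ∈ W) {w : V}
    (hw : w ∈ W) (hw0 : w ≠ 0) : W = ⊤ := by
  refine ((ρ.isIrreducible_iff_forall.1 h).2 W hW).resolve_left ?_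
  rintro rfl
  exact hw0 ((Submodule.mem_bot ℂ).1 hw)

theorem IsIrreducible.finrank_eq_one_of_forall_smul {G : Type} [Group G]
    {ρ : Representation ℂ G V} (h : ρ.IsIrreducible) {w : V} (hw0 : w ≠ 0)
    (hw : ∀ g, ∃ c : ℂ, ρ g w = c • w) : Module.finrank ℂ V = 1 := by
  have := h.eq_top_of_mem (Submodule.span ℂ {w}) (fun g x hx => by
    obtain ⟨a, rfl⟩ := Submodule.mem_span_singleton.1 hx
    obtain ⟨c, hc⟩ := hw g
    rw [map_smul, hc]
    exact Submodule.smul_mem _ _ (Submodule.smul_mem _ _ (Submodule.mem_span_singleton_self w)))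
    (Submodule.mem_span_singleton_self w) hw0
  rw [← finrank_top, ← this, finrank_span_singleton hw0]

/-- An irreducible representation generated by vectors permuted as the points. -/
theorem IsIrreducible.finrank_of_equivariant_point [FiniteDimensional ℂ V] (h : ρ.IsIrreducible)
    (u : α → V) (hu : ∀ g i, ρ g (u i) = u (g i)) {i₀ : α} (hi₀ : u i₀ ≠ 0) :
    Module.finrank ℂ V = 1 ∨ Module.finrank ℂ V = Fintype.card α - 1 := by
  by_cases hw : ∑ i, u i = 0
  · right
    let Λ : (α → ℂ) →ₗ[ℂ] V := Fintype.linearCombination ℂ u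
    have hΛ : ∀ c, Λ c = ∑ i, c i • u i := fun c => rfl
    have hrange : LinearMap.range Λ = ⊤ := by
      refine h.eq_top_of_mem _ ?_ (w := u i₀) ⟨Pi.single i₀ 1, by simp [Λ]⟩ hi₀
      rintro g _ ⟨c, rfl⟩
      refine ⟨c ∘ g.symm, ?_⟩
      rw [hΛ, hΛ, map_sum, ← Equiv.sum_comp g]
      exact Finset.sum_congr rfl fun i _ => by simp [hu]
    have hne : ∀ a b, a ≠ b → u a ≠ u b := by
      intro a b hab heq
      have hall : ∀ j, u j = u i₀ := by
        intro j
        by_cases hj : j = i₀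
        · rw [hj]
        · obtain ⟨g, h1, h2⟩ := Equiv.Perm.exists_apply_eq_apply_eq hab hj
          rw [← h1, ← h2, ← hu, ← hu, heq]
      rw [Finset.sum_congr rfl fun j _ => hall j, Finset.sum_const, ← Nat.cast_smul_eq_nsmul ℂ,
        smul_eq_zero] at hw
      refine hi₀ (hw.resolve_left ?_)
      rw [Finset.card_univ, Nat.cast_eq_zero]
      exact (Fintype.card_pos_iff.2 ⟨i₀⟩).ne'
    have hker : LinearMap.ker Λ = Submodule.span ℂ {fun _ => 1} := by
      ext c
      rw [LinearMap.mem_ker, Submodule.mem_span_singleton]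
      constructor
      · intro hc
        refine ⟨c i₀, funext fun j => ?_⟩
        by_cases hj : j = i₀
        · simp [hj]
        have h1 : ρ (Equiv.swap i₀ j) (Λ c) = ∑ i, c (Equiv.swap i₀ j i) • u i := by
          rw [hΛ, map_sum, ← Equiv.sum_comp (Equiv.swap i₀ j)]
          exact Finset.sum_congr rfl fun i _ => by simp [hu]
        rw [hc, map_zero] at h1
        have h2 : ∑ i, (c i - c (Equiv.swap i₀ j i)) • u i = (c i₀ - c j) • (u i₀ - u j) := by
          rw [← Finset.add_sum_erase _ _ (Finset.mem_univ i₀),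
            ← Finset.add_sum_erase _ _ (Finset.mem_erase.2 ⟨hj, Finset.mem_univ j⟩),
            Finset.sum_eq_zero]
          · simp only [Equiv.swap_apply_left, Equiv.swap_apply_right]
            module
          · intro i hi
            simp only [Finset.mem_erase] at hi
            rw [Equiv.swap_apply_of_ne_of_ne hi.2.1 hi.1, sub_self, zero_smul]
        simp only [sub_smul, Finset.sum_sub_distrib] at h2
        rw [← h1, ← hΛ, hc, sub_self, ← sub_smul, eq_comm, smul_eq_zero] at h2
        have h3 := h2.resolve_right (sub_ne_zero.2 (hne _ _ (Ne.symm hj)))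
        simpa using sub_eq_zero.1 h3
      · rintro ⟨a, rfl⟩
        rw [hΛ]
        simp [← Finset.smul_sum, hw]
    have hdim := Λ.finrank_range_add_finrank_ker
    rw [hrange, finrank_top, hker, Module.finrank_fintype_fun_eq_card,
      finrank_span_singleton (fun h => one_ne_zero (congrFun h i₀))] at hdim
    omega
  · left
    refine h.finrank_eq_one_of_forall_smul hw fun g => ⟨1, ?_⟩
    rw [map_sum, one_smul, ← Equiv.sum_comp g u]
    exact Finset.sum_congr rfl fun i _ => hu g i

/-- The sum of the translates of a vector that send the pair `(p, q)` to `(i, j)`. -/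
noncomputable def pairSum (ρ : Representation ℂ (Equiv.Perm α) V) (p q : α) (v : V) (i j : α) : V :=
  ∑ σ with σ p = i ∧ σ q = j, ρ σ v

theorem apply_pairSum (p q : α) (v : V) (g : Equiv.Perm α) (i j : α) :
    ρ g (ρ.pairSum p q v i j) = ρ.pairSum p q v (g i) (g j) := by
  rw [pairSum, pairSum, map_sum]
  refine Finset.sum_bij' (fun σ _ => g * σ) (fun σ _ => g⁻¹ * σ) ?_ ?_ ?_ ?_ ?_
  · intro σ hσ
    simpa using hσ
  · intro σ hσ
    simp only [Finset.mem_filter, Finset.mem_univ, true_and] at hσ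
    simp [hσ.1, hσ.2]
  · intro σ _; simp
  · intro σ _; simp
  · intro σ _; rw [map_mul]; rfl

theorem pairSum_self {p q : α} (hpq : p ≠ q) (v : V) (i : α) : ρ.pairSum p q v i i = 0 := by
  refine Finset.sum_eq_zero fun σ hσ => ?_
  have := (Finset.mem_filter.1 hσ).2
  exact absurd (σ.injective (this.1.trans this.2.symm)) hpq

theorem pairSum_swap {p q : α} {v : V} {ε : ℂ} (hv : ρ (Equiv.swap p q) v = ε • v) (i j : α) :
    ρ.pairSum p q v j i = ε • ρ.pairSum p q v i j := by
  rw [pairSum, pairSum, Finset.smul_sum]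
  refine Finset.sum_bij' (fun σ _ => σ * Equiv.swap p q) (fun σ _ => σ * Equiv.swap p q)
    ?_ ?_ ?_ ?_ ?_
  · intro σ hσ
    simp only [Finset.mem_filter, Finset.mem_univ, true_and] at hσ
    simp [hσ.1, hσ.2]
  · intro σ hσ
    simp only [Finset.mem_filter, Finset.mem_univ, true_and] at hσ
    simp [hσ.1, hσ.2]
  · intro σ _; simp [mul_assoc]
  · intro σ _; simp [mul_assoc]
  · intro σ _
    rw [← map_smul, ← hv, ← Module.End.mul_apply, ← map_mul, mul_assoc, Equiv.swap_mul_self,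
      mul_one]

theorem pairSum_ne_zero {p q : α} {v : V} (hv0 : v ≠ 0)
    (hv : ∀ σ : Equiv.Perm α, σ p = p → σ q = q → ρ σ v = v) : ρ.pairSum p q v p q ≠ 0 := by
  rw [pairSum, Finset.sum_congr rfl fun σ hσ => hv σ (Finset.mem_filter.1 hσ).2.1
    (Finset.mem_filter.1 hσ).2.2, Finset.sum_const, ← Nat.cast_smul_eq_nsmul ℂ]
  refine smul_ne_zero ?_ hv0
  rw [Nat.cast_ne_zero]
  exact Finset.card_ne_zero_of_mem (a := 1) (by simp)

/-- Many independent vectors among the second differences of an equivariant function on pairs. -/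
theorem two_mul_card_sub_three_le_finrank [FiniteDimensional ℂ V] (f : α → α → V)
    (hf : ∀ g i j, ρ g (f i j) = f (g i) (g j)) {r s t : α} (hrs : r ≠ s) (hrt : r ≠ t)
    (hst : s ≠ t)
    (hne : ∀ e : ℂ, e = 1 ∨ e = -1 → ∀ a, a ≠ r → a ≠ s → a ≠ t →
      f r a - f r t + e • (f s a - f s t) ≠ 0) :
    2 * (Fintype.card α - 3) ≤ Module.finrank ℂ V := by
  let T := {a : α // a ∈ ((Finset.univ.erase r).erase s).erase t}
  have hT : Fintype.card T = Fintype.card α - 3 := by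
    rw [Fintype.card_coe, Finset.card_erase_of_mem (by simp [hrt.symm, hst.symm]),
      Finset.card_erase_of_mem (by simp [hrs.symm]), Finset.card_erase_of_mem (by simp),
      Finset.card_univ]
    omega
  have hmem : ∀ a : T, (a : α) ≠ t ∧ (a : α) ≠ s ∧ (a : α) ≠ r := fun a => by
    have := a.2
    simp only [Finset.mem_erase, Finset.mem_univ, and_true] at this
    exact this
  have hpair : ∀ a : T, ∀ c d : ℂ, c • (f r a - f r t) + d • (f s a - f s t) = 0 →
      c = 0 ∧ d = 0 := by
    intro a c d hcd
    obtain ⟨hat, has, har⟩ := hmem a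
    have h1 := congrArg (ρ (Equiv.swap r s)) hcd
    simp only [map_add, map_smul, map_sub, hf, Equiv.swap_apply_left, Equiv.swap_apply_right,
      Equiv.swap_apply_of_ne_of_ne har has, Equiv.swap_apply_of_ne_of_ne hrt.symm hst.symm,
      map_zero] at h1
    have h2 : (c + d) • (f r a - f r t + (1 : ℂ) • (f s a - f s t)) = 0 := by
      linear_combination (norm := module) hcd + h1
    have h3 : (c - d) • (f r a - f r t + (-1 : ℂ) • (f s a - f s t)) = 0 := by
      linear_combination (norm := module) hcd - h1
    have h4 := (smul_eq_zero.1 h2).resolve_right (hne 1 (Or.inl rfl) a har has hat)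
    have h5 := (smul_eq_zero.1 h3).resolve_right (hne (-1) (Or.inr rfl) a har has hat)
    exact ⟨by linear_combination (h4 + h5) / 2, by linear_combination (h4 - h5) / 2⟩
  have hcoef : ∀ c : T → ℂ, (∀ a, c a + ∑ b, c b = 0) → ∀ a, c a = 0 := by
    intro c hc
    have h1 : ∑ a, (c a + ∑ b, c b) = 0 := Finset.sum_eq_zero fun a _ => hc a
    rw [Finset.sum_add_distrib, Finset.sum_const, nsmul_eq_mul] at h1
    have h2 : ((Fintype.card T : ℂ) + 1) * ∑ b, c b = 0 := by
      rw [Finset.card_univ] at h1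
      linear_combination h1
    have h3 := (mul_eq_zero.1 h2).resolve_left (Nat.cast_add_one_ne_zero _)
    intro a
    simpa [h3] using hc a
  have hli : LinearIndependent ℂ
      (Sum.elim (fun a : T => f r a - f r t) (fun a : T => f s a - f s t)) := by
    rw [Fintype.linearIndependent_iff]
    intro c hc
    rw [Fintype.sum_sum_type] at hc
    simp only [Sum.elim_inl, Sum.elim_inr] at hc
    have hstep : ∀ (x : α), x ≠ t → ∀ (c : T → ℂ) (a : T), x ≠ a →
        ∑ b, c b • (f x b - f x t) - ρ (Equiv.swap (a : α) t) (∑ b, c b • (f x b - f x t)) =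
          (c a + ∑ b, c b) • (f x a - f x t) := by
      intro x hxt c a hxa
      obtain ⟨hat, -, -⟩ := hmem a
      rw [map_sum, ← Finset.sum_sub_distrib, add_smul, Finset.sum_smul,
        ← Finset.add_sum_erase _ _ (Finset.mem_univ a),
        ← Finset.add_sum_erase (a := a) _ (fun b => c b • (f x a - f x t)) (Finset.mem_univ a),
        ← add_assoc]
      congr 1
      · simp only [map_smul, map_sub, hf, Equiv.swap_apply_left, Equiv.swap_apply_right,
          Equiv.swap_apply_of_ne_of_ne hxa hxt]
        module
      · refine Finset.sum_congr rfl fun b hb => ?_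
        have hba : (b : α) ≠ a := fun h => Finset.ne_of_mem_erase hb (Subtype.ext h)
        simp only [map_smul, map_sub, hf, Equiv.swap_apply_right,
          Equiv.swap_apply_of_ne_of_ne hxa hxt,
          Equiv.swap_apply_of_ne_of_ne hba (hmem b).1]
        module
    have hboth : ∀ a : T, (c (Sum.inl a) + ∑ b, c (Sum.inl b)) = 0 ∧
        (c (Sum.inr a) + ∑ b, c (Sum.inr b)) = 0 := by
      intro a
      obtain ⟨hat, has, har⟩ := hmem a
      refine hpair a _ _ ?_
      have h1 := hstep r hrt (fun b => c (Sum.inl b)) a har.symm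
      have h2 := hstep s hst (fun b => c (Sum.inr b)) a has.symm
      rw [← h1, ← h2, sub_add_sub_comm, ← map_add, hc, map_zero, sub_zero]
    have hl := hcoef _ fun a => (hboth a).1
    have hr := hcoef _ fun a => (hboth a).2
    rintro (a | a)
    · exact hl a
    · exact hr a
  have := hli.fintype_card_le_finrank
  rw [Fintype.card_sum, hT] at this
  omega

/-- The degree of an irreducible representation with a vector fixed by the stabilizer of two
points. -/
theorem IsIrreducible.finrank_of_fixed_pair [FiniteDimensional ℂ V] (h : ρ.IsIrreducible)
    (hα : 5 ≤ Fintype.card α) {p q : α} (hpq : p ≠ q) {v : V} (hv0 : v ≠ 0)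
    (hv : ∀ σ : Equiv.Perm α, σ p = p → σ q = q → ρ σ v = v) {ε : ℂ} (hε : ε = 1 ∨ ε = -1)
    (hswap : ρ (Equiv.swap p q) v = ε • v) :
    Module.finrank ℂ V = 1 ∨ Module.finrank ℂ V = Fintype.card α - 1 ∨
      2 * (Fintype.card α - 3) ≤ Module.finrank ℂ V := by
  set f := ρ.pairSum p q v with hfdef
  have hf : ∀ g i j, ρ g (f i j) = f (g i) (g j) := apply_pairSum p q v
  have hf0 : f p q ≠ 0 := pairSum_ne_zero hv0 hv
  by_cases hrow : ∀ i, ∑ j, f i j = 0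
  · right; right
    obtain ⟨t, htp, htq, -⟩ := exists_ne_ne_ne (by omega) p q q
    refine two_mul_card_sub_three_le_finrank f hf hpq htp.symm htq.symm ?_
    intro e he a hap haq hat hrel
    refine hf0 (pair_function_eq_zero hα f hε he (pairSum_self hpq v) (pairSum_swap hswap) hrow
      ?_ p q)
    intro i j b c hij hbc hib hic hjb hjc
    obtain ⟨g, hg⟩ := Equiv.Perm.exists_forall_apply_eq
      (injective_vecFour hpq hap.symm htp.symm haq.symm htq.symm hat)
      (injective_vecFour hij hib hic hjb hjc hbc)
    have h0 : g p = i := hg 0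
    have h1 : g q = j := hg 1
    have h2 : g a = b := hg 2
    have h3 : g t = c := hg 3
    simpa only [map_add, map_smul, map_sub, hf, h0, h1, h2, h3, map_zero] using congrArg (ρ g) hrel
  · push Not at hrow
    obtain ⟨i₀, hi₀⟩ := hrow
    have := h.finrank_of_equivariant_point (fun i => ∑ j, f i j) (fun g i => ?_) hi₀
    · tauto
    · rw [map_sum, ← Equiv.sum_comp g (f (g i))]
      exact Finset.sum_congr rfl fun j _ => hf g i j

theorem exists_isIrreducible_restrictTo {G V : Type} [Group G] [AddCommGroup V] [Module ℂ V]
    [FiniteDimensional ℂ V] [Nontrivial V] (ρ : Representation ℂ G V) :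
    ∃ (W : Submodule ℂ V) (hW : ∀ g, ∀ w ∈ W, ρ g w ∈ W), (ρ.restrictTo W hW).IsIrreducible := by
  classical
  have hex : ∃ n, ∃ W : Submodule ℂ V, (∀ g, ∀ w ∈ W, ρ g w ∈ W) ∧ W ≠ ⊥ ∧
      Module.finrank ℂ W = n := ⟨_, ⊤, fun _ _ _ => Submodule.mem_top, top_ne_bot, rfl⟩
  obtain ⟨W, hW, hW0, hdim⟩ := Nat.find_spec hex
  refine ⟨W, hW, (isIrreducible_iff_forall _).2
    ⟨(Submodule.nontrivial_iff_ne_bot).2 hW0, fun U hU => ?_⟩⟩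
  by_cases hU0 : U = ⊥
  · exact Or.inl hU0
  right
  apply Submodule.eq_top_of_finrank_eq
  refine le_antisymm (Submodule.finrank_le U) ?_
  rw [hdim]
  refine Nat.find_min' hex ⟨U.map W.subtype, ?_, ?_, ?_⟩
  · rintro g _ ⟨u, hu, rfl⟩
    exact ⟨ρ.restrictTo W hW g u, hU g u hu, rfl⟩
  · exact fun h => hU0 (Submodule.map_injective_of_injective W.injective_subtype
      (h.trans (Submodule.map_bot _).symm))
  · exact Submodule.finrank_map_subtype_eq W U

section Symmetric

variable {α V : Type} [DecidableEq α] [AddCommGroup V] [Module ℂ V]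
  {ρ : Representation ℂ (Equiv.Perm α) V}

theorem mul_swap_conj (ρ : Representation ℂ (Equiv.Perm α) V) (g : Equiv.Perm α) (a b : α) :
    ρ (Equiv.swap (g a) (g b)) = ρ g * ρ (Equiv.swap a b) * ρ g⁻¹ := by
  rw [Equiv.swap_apply_apply, map_mul, map_mul]

theorem forall_eq_or_forall_sign_of_swap_eq_smul [Fintype α] [Nontrivial V] {p q : α}
    (hpq : p ≠ q) {c : ℂ}
    (hc : ∀ v, ρ (Equiv.swap p q) v = c • v) :
    (∀ σ v, ρ σ v = v) ∨ ∀ σ v, ρ σ v = ((Equiv.Perm.sign σ : ℤ) : ℂ) • v := by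
  have hall : ∀ x y, x ≠ y → ∀ v, ρ (Equiv.swap x y) v = c • v := by
    intro x y hxy v
    obtain ⟨g, rfl, rfl⟩ := Equiv.Perm.exists_apply_eq_apply_eq hpq hxy
    rw [mul_swap_conj, Module.End.mul_apply, Module.End.mul_apply, hc, map_smul,
      ← Module.End.mul_apply, ← map_mul, mul_inv_cancel, map_one, Module.End.one_apply]
  obtain ⟨v, hv⟩ := exists_ne (0 : V)
  have hsq : c * c = 1 := by
    have h1 : ρ (Equiv.swap p q * Equiv.swap p q) v = v := by
      rw [Equiv.swap_mul_self, map_one, Module.End.one_apply]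
    rw [map_mul, Module.End.mul_apply, hc, hc, smul_smul] at h1
    have h2 : (c * c - 1) • v = 0 := by rw [sub_smul, h1, one_smul, sub_self]
    exact sub_eq_zero.1 ((smul_eq_zero.1 h2).resolve_right hv)
  rcases mul_self_eq_one_iff.1 hsq with rfl | rfl
  · left
    intro σ
    induction σ using Equiv.Perm.swap_induction_on with
    | one => simp
    | swap_mul σ x y hxy ih =>
      intro v
      rw [map_mul, Module.End.mul_apply, ih, hall x y hxy, one_smul]
  · right
    intro σ
    induction σ using Equiv.Perm.swap_induction_on with
    | one => simp
    | swap_mul σ x y hxy ih =>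
      intro v
      rw [map_mul, Module.End.mul_apply, ih, hall x y hxy, Equiv.Perm.sign_mul,
        Equiv.Perm.sign_swap hxy]
      simp

theorem IsIrreducible.finrank_eq_one_of_swap_eq_smul [Fintype α] (h : ρ.IsIrreducible)
    {p q : α} (hpq : p ≠ q) {c : ℂ} (hc : ∀ v, ρ (Equiv.swap p q) v = c • v) :
    Module.finrank ℂ V = 1 := by
  obtain ⟨hV, -⟩ := ρ.isIrreducible_iff_forall.1 h
  obtain ⟨v, hv⟩ := exists_ne (0 : V)
  refine h.finrank_eq_one_of_forall_smul hv fun g => ?_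
  rcases forall_eq_or_forall_sign_of_swap_eq_smul hpq hc with h1 | h1
  · exact ⟨1, by rw [h1, one_smul]⟩
  · exact ⟨_, h1 g v⟩

/-- The representation has a nonzero vector on which the symmetric group acts trivially or by the
sign. -/
def HasSemiInvariant [Fintype α] (ρ : Representation ℂ (Equiv.Perm α) V) : Prop :=
  ∃ w, w ≠ 0 ∧ ((∀ σ, ρ σ w = w) ∨ ∀ σ, ρ σ w = ((Equiv.Perm.sign σ : ℤ) : ℂ) • w)

theorem hasSemiInvariant_or_le_finrank [Fintype α] [FiniteDimensional ℂ V] [Nontrivial V] {B : ℕ}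
    (hα : 2 ≤ Fintype.card α)
    (hB : ∀ (W : Type) [AddCommGroup W] [Module ℂ W] [FiniteDimensional ℂ W]
      (π : Representation ℂ (Equiv.Perm α) W), π.IsIrreducible →
        Module.finrank ℂ W = 1 ∨ B ≤ Module.finrank ℂ W)
    (ρ : Representation ℂ (Equiv.Perm α) V) : ρ.HasSemiInvariant ∨ B ≤ Module.finrank ℂ V := by
  obtain ⟨W, hW, hirr⟩ := ρ.exists_isIrreducible_restrictTo
  rcases hB W _ hirr with h1 | h1
  · left
    obtain ⟨p, q, hpq⟩ := Fintype.exists_pair_of_one_lt_card hα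
    obtain ⟨hWn, -⟩ := (isIrreducible_iff_forall _).1 hirr
    obtain ⟨c, hc⟩ : ∃ c : ℂ, ∀ w, ρ.restrictTo W hW (Equiv.swap p q) w = c • w := by
      obtain ⟨w, hw⟩ := exists_ne (0 : W)
      obtain ⟨c, hc⟩ := exists_smul_eq_of_finrank_eq_one h1 hw
        (ρ.restrictTo W hW (Equiv.swap p q) w)
      refine ⟨c, fun x => ?_⟩
      obtain ⟨a, rfl⟩ := exists_smul_eq_of_finrank_eq_one h1 hw x
      rw [map_smul, ← hc, smul_comm]
    obtain ⟨w, hw⟩ := exists_ne (0 : W)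
    refine ⟨w, by simpa using hw, ?_⟩
    rcases forall_eq_or_forall_sign_of_swap_eq_smul hpq hc with h2 | h2
    · exact Or.inl fun σ => congrArg Subtype.val (h2 σ w)
    · exact Or.inr fun σ => congrArg Subtype.val (h2 σ w)
  · exact Or.inr (h1.trans (Submodule.finrank_le W))

/-- The twist by the sign character. -/
noncomputable def signTwist [Fintype α] (ρ : Representation ℂ (Equiv.Perm α) V) :
    Representation ℂ (Equiv.Perm α) V where
  toFun σ := ((Equiv.Perm.sign σ : ℤ) : ℂ) • ρ σ
  map_one' := by simp
  map_mul' σ τ := by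
    ext v
    simp [smul_smul, mul_comm]

theorem signTwist_apply [Fintype α] (σ : Equiv.Perm α) (v : V) :
    ρ.signTwist σ v = ((Equiv.Perm.sign σ : ℤ) : ℂ) • ρ σ v := rfl

theorem sign_mul_self [Fintype α] (σ : Equiv.Perm α) :
    ((Equiv.Perm.sign σ : ℤ) : ℂ) * ((Equiv.Perm.sign σ : ℤ) : ℂ) = 1 := by
  rcases Int.units_eq_one_or (Equiv.Perm.sign σ) with h | h <;> simp [h]

theorem IsIrreducible.signTwist [Fintype α] (h : ρ.IsIrreducible) : ρ.signTwist.IsIrreducible := by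
  rw [isIrreducible_iff_forall] at h ⊢
  refine ⟨h.1, fun W hW => h.2 W fun g w hw => ?_⟩
  have h1 := W.smul_mem ((Equiv.Perm.sign g : ℤ) : ℂ) (hW g w hw)
  rwa [signTwist_apply, smul_smul, sign_mul_self, one_smul] at h1

/-- Restriction to the permutations of the points other than `p` and `q`. -/
def offPair (ρ : Representation ℂ (Equiv.Perm α) V) (p q : α) :
    Representation ℂ (Equiv.Perm {x : α // x ≠ p ∧ x ≠ q}) V :=
  ρ.comp Equiv.Perm.ofSubtype

theorem offPair_apply_mem_eigenspace (p q : α) (c : ℂ)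
    (σ : Equiv.Perm {x : α // x ≠ p ∧ x ≠ q}) :
    ∀ v ∈ Module.End.eigenspace (ρ (Equiv.swap p q)) c,
      ρ.offPair p q σ v ∈ Module.End.eigenspace (ρ (Equiv.swap p q)) c := by
  intro v hv
  rw [Module.End.mem_eigenspace_iff] at hv ⊢
  have hcomm : Equiv.swap p q * Equiv.Perm.ofSubtype σ =
      Equiv.Perm.ofSubtype σ * Equiv.swap p q := by
    have := Equiv.swap_apply_apply (Equiv.Perm.ofSubtype σ) p q
    rw [Equiv.Perm.ofSubtype_apply_of_not_mem σ (by simp),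
      Equiv.Perm.ofSubtype_apply_of_not_mem σ (by simp)] at this
    rw [eq_mul_inv_iff_mul_eq] at this
    exact this
  change ρ (Equiv.swap p q) (ρ (Equiv.Perm.ofSubtype σ) v) = c • ρ (Equiv.Perm.ofSubtype σ) v
  rw [← Module.End.mul_apply, ← map_mul, hcomm, map_mul, Module.End.mul_apply, hv, map_smul]

theorem isCompl_eigenspace_swap (p q : α) :
    IsCompl (Module.End.eigenspace (ρ (Equiv.swap p q)) 1)
      (Module.End.eigenspace (ρ (Equiv.swap p q)) (-1)) := by
  constructor
  · rw [Submodule.disjoint_def]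
    intro v h1 h2
    rw [Module.End.mem_eigenspace_iff] at h1 h2
    rw [h1] at h2
    exact (smul_eq_zero.1 (by linear_combination (norm := module) h2 :
      (2 : ℂ) • v = 0)).resolve_left two_ne_zero
  · rw [codisjoint_iff, eq_top_iff]
    intro v _
    have hsq : ρ (Equiv.swap p q) (ρ (Equiv.swap p q) v) = v := by
      rw [← Module.End.mul_apply, ← map_mul, Equiv.swap_mul_self, map_one, Module.End.one_apply]
    refine Submodule.mem_sup.2 ⟨(1 / 2 : ℂ) • (v + ρ (Equiv.swap p q) v), ?_,
      (1 / 2 : ℂ) • (v - ρ (Equiv.swap p q) v), ?_, by module⟩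
    · rw [Module.End.mem_eigenspace_iff, map_smul, map_add, hsq]
      module
    · rw [Module.End.mem_eigenspace_iff, map_smul, map_sub, hsq]
      module

theorem IsIrreducible.finrank_of_hasSemiInvariant [Fintype α] [FiniteDimensional ℂ V]
    (h : ρ.IsIrreducible) (hα : 5 ≤ Fintype.card α) {p q : α} (hpq : p ≠ q) {ε : ℂ}
    (hε : ε = 1 ∨ ε = -1)
    (hs : ((ρ.offPair p q).restrictTo (Module.End.eigenspace (ρ (Equiv.swap p q)) ε)
      (offPair_apply_mem_eigenspace p q ε)).HasSemiInvariant) :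
    Module.finrank ℂ V = 1 ∨ Module.finrank ℂ V = Fintype.card α - 1 ∨
      2 * (Fintype.card α - 3) ≤ Module.finrank ℂ V := by
  obtain ⟨⟨v, hv⟩, hv0, hs⟩ := hs
  have hv0 : v ≠ 0 := fun h0 => hv0 (Subtype.ext h0)
  rw [Module.End.mem_eigenspace_iff] at hv
  have hext : ∀ σ : Equiv.Perm α, σ p = p → σ q = q →
      ∃ τ : Equiv.Perm {x : α // x ≠ p ∧ x ≠ q}, Equiv.Perm.ofSubtype τ = σ := by
    intro σ hp hq
    refine ⟨σ.subtypePerm fun x => ?_, Equiv.Perm.ofSubtype_subtypePerm _ fun x hx => ?_⟩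
    · rw [Ne, Ne, ← σ.eq_symm_apply, ← σ.eq_symm_apply,
        σ.symm_apply_eq.2 hp.symm, σ.symm_apply_eq.2 hq.symm]
    · refine ⟨?_, ?_⟩
      · rintro rfl; exact hx hp
      · rintro rfl; exact hx hq
  rcases hs with hs | hs
  · refine h.finrank_of_fixed_pair hα hpq hv0 (fun σ hp hq => ?_) hε hv
    obtain ⟨τ, rfl⟩ := hext σ hp hq
    exact congrArg Subtype.val (hs τ)
  · refine h.signTwist.finrank_of_fixed_pair hα hpq hv0 (fun σ hp hq => ?_) (ε := -ε) ?_ ?_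
    · obtain ⟨τ, rfl⟩ := hext σ hp hq
      have h1 : ρ (Equiv.Perm.ofSubtype τ) v = ((Equiv.Perm.sign τ : ℤ) : ℂ) • v :=
        congrArg Subtype.val (hs τ)
      rw [signTwist_apply, h1, Equiv.Perm.sign_ofSubtype, smul_smul, sign_mul_self, one_smul]
    · rcases hε with rfl | rfl <;> simp
    · rw [signTwist_apply, hv, Equiv.Perm.sign_swap hpq]
      simp

theorem exists_eq_smul_of_mul_self_eq_one (hV : Module.finrank ℂ V = 2)
    {T : Module.End ℂ V} (hT : T * T = 1) (hdet : LinearMap.det T = 1) :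
    ∃ c : ℂ, T = c • 1 := by
  have := Module.finite_of_finrank_pos (R := ℂ) (M := V) (by omega)
  let b := Module.finBasisOfFinrankEq ℂ V hV
  set A := LinearMap.toMatrix b b T with hA
  have h1 : A * A = 1 := by rw [hA, ← LinearMap.toMatrix_mul, hT, LinearMap.toMatrix_one]
  have h2 : A.det = 1 := by rw [hA, LinearMap.det_toMatrix, hdet]
  have h3 : A.adjugate = A := by
    have : A * (A * A.adjugate) = A := by rw [Matrix.mul_adjugate, h2, one_smul, mul_one]
    rwa [← mul_assoc, h1, one_mul] at this
  rw [Matrix.adjugate_fin_two] at h3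
  have h00 := congrFun (congrFun h3 0) 0
  have h01 := congrFun (congrFun h3 0) 1
  have h10 := congrFun (congrFun h3 1) 0
  simp at h00 h01 h10
  refine ⟨A 0 0, (LinearMap.toMatrix b b).injective ?_⟩
  rw [← hA, map_smul, LinearMap.toMatrix_one]
  have hzero : A 0 1 = 0 := by linear_combination -h01 / 2
  have hone : A 1 0 = 0 := by linear_combination -h10 / 2
  ext i j
  fin_cases i <;> fin_cases j <;> simp [h00, hzero, hone]

/-- Double transpositions act trivially in a two-dimensional representation. -/
theorem swap_mul_swap_eq_one_of_finrank_eq_two (hV : Module.finrank ℂ V = 2) {a b c d : α}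
    (hab : a ≠ b) (hac : a ≠ c) (had : a ≠ d) (hbc : b ≠ c) (hbd : b ≠ d) (hcd : c ≠ d) :
    ρ (Equiv.swap a b * Equiv.swap c d) = 1 := by
  have : Nontrivial V := Module.nontrivial_of_finrank_pos (R := ℂ) (by omega)
  obtain ⟨v, hv⟩ := exists_ne (0 : V)
  set x := Equiv.swap a b * Equiv.swap c d with hx
  have hxx : x * x = 1 := by
    ext t
    simp only [hx, Equiv.Perm.mul_apply, Equiv.swap_apply_def, Equiv.Perm.one_apply]
    grind
  let y := Equiv.swap b c * x * (Equiv.swap b c)⁻¹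
  let z := Equiv.swap b d * x * (Equiv.swap b d)⁻¹
  have hxy : x * y = z := by
    ext t
    simp only [x, y, z, Equiv.Perm.mul_apply, Equiv.swap_apply_def, Equiv.swap_inv]
    grind
  have hdetconj : ∀ g, LinearMap.det (ρ (g * x * g⁻¹)) = LinearMap.det (ρ x) := by
    intro g
    rw [map_mul ρ, map_mul ρ, map_mul LinearMap.det, map_mul LinearMap.det, mul_right_comm,
      ← map_mul LinearMap.det, ← map_mul ρ, mul_inv_cancel, map_one, map_one, one_mul]
  have hsq : ρ x * ρ x = 1 := by rw [← map_mul, hxx, map_one]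
  have hdet : LinearMap.det (ρ x) = 1 := by
    have h1 : LinearMap.det (ρ x) * LinearMap.det (ρ x) = 1 := by
      rw [← map_mul, hsq, map_one]
    have h2 : LinearMap.det (ρ x) * LinearMap.det (ρ x) = LinearMap.det (ρ x) := by
      have h3 : LinearMap.det (ρ (x * y)) = LinearMap.det (ρ z) := by rw [hxy]
      rwa [map_mul ρ, map_mul LinearMap.det, hdetconj, hdetconj] at h3
    rw [← h2, h1]
  obtain ⟨c, hc⟩ := exists_eq_smul_of_mul_self_eq_one hV hsq hdet
  have hconj : ∀ g, ρ (g * x * g⁻¹) = c • 1 := by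
    intro g
    rw [map_mul, map_mul, hc, mul_smul_comm, mul_one, smul_mul_assoc, ← map_mul, mul_inv_cancel,
      map_one]
  have h1 : (c * c) • v = c • v := by
    have h2 : ρ x * ρ y = ρ z := by rw [← map_mul, hxy]
    rw [hconj, hconj, hc] at h2
    simpa [smul_smul] using LinearMap.congr_fun h2 v
  have h2 : (c * c) • v = v := by
    rw [hc] at hsq
    simpa [smul_smul] using LinearMap.congr_fun hsq v
  have h3 : c = 1 := by
    rw [h2] at h1
    have : (c - 1) • v = 0 := by rw [sub_smul, ← h1, one_smul, sub_self]
    exact sub_eq_zero.1 ((smul_eq_zero.1 this).resolve_right hv)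
  rw [hc, h3, one_smul]

theorem IsIrreducible.finrank_eq_one_of_swap_mul_swap_eq_one [Fintype α] [FiniteDimensional ℂ V]
    (h : ρ.IsIrreducible) (hα : 6 ≤ Fintype.card α) {a b c d : α}
    (hab : a ≠ b) (hac : a ≠ c) (had : a ≠ d) (hbc : b ≠ c) (hbd : b ≠ d) (hcd : c ≠ d)
    (hρ : ρ (Equiv.swap a b * Equiv.swap c d) = 1) : Module.finrank ℂ V = 1 := by
  have heq : ρ (Equiv.swap a b) = ρ (Equiv.swap c d) := by
    rw [map_mul] at hρ
    calc ρ (Equiv.swap a b) = ρ (Equiv.swap a b) * ρ (Equiv.swap c d * Equiv.swap c d) := by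
          rw [Equiv.swap_mul_self, map_one, mul_one]
      _ = ρ (Equiv.swap c d) := by rw [map_mul, ← mul_assoc, hρ, one_mul]
  have hall : ∀ w x y z, w ≠ x → w ≠ y → w ≠ z → x ≠ y → x ≠ z → y ≠ z →
      ρ (Equiv.swap w x) = ρ (Equiv.swap y z) := by
    intro w x y z hwx hwy hwz hxy hxz hyz
    obtain ⟨g, hg⟩ := Equiv.Perm.exists_forall_apply_eq
      (injective_vecFour hab hac had hbc hbd hcd)
      (injective_vecFour hwx hwy hwz hxy hxz hyz)
    have h0 : g a = w := hg 0
    have h1 : g b = x := hg 1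
    have h2 : g c = y := hg 2
    have h3 : g d = z := hg 3
    rw [← h0, ← h1, ← h2, ← h3, mul_swap_conj, mul_swap_conj, heq]
  have hcomm : ∀ g : Equiv.Perm α, ρ (Equiv.swap (g a) (g b)) = ρ (Equiv.swap a b) := by
    intro g
    have hcard : 1 < ({a, b, g a, g b} : Finset α)ᶜ.card := by
      rw [Finset.card_compl]
      have := Finset.card_le_four (a := a) (b := b) (c := g a) (d := g b)
      omega
    obtain ⟨y, hy, z, hz, hyz⟩ := Finset.one_lt_card.1 hcard
    simp only [Finset.mem_compl, Finset.mem_insert, Finset.mem_singleton, not_or] at hy hz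
    have hgab : g a ≠ g b := fun h => hab (g.injective h)
    rw [hall (g a) (g b) y z hgab (Ne.symm hy.2.2.1) (Ne.symm hz.2.2.1) (Ne.symm hy.2.2.2)
      (Ne.symm hz.2.2.2) hyz, hall a b y z hab (Ne.symm hy.1) (Ne.symm hz.1) (Ne.symm hy.2.1)
      (Ne.symm hz.2.1) hyz]
  obtain ⟨c, hc⟩ := h.exists_eq_smul (ρ (Equiv.swap a b)) fun g v => by
    have h1 := hcomm g
    rw [mul_swap_conj] at h1
    conv_lhs => rw [← h1]
    rw [Module.End.mul_apply, Module.End.mul_apply, ← Module.End.mul_apply (ρ g⁻¹), ← map_mul,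
      inv_mul_cancel, map_one, Module.End.one_apply]
  exact h.finrank_eq_one_of_swap_eq_smul hab hc

end Symmetric

section Dichotomy

variable {α V : Type} [Fintype α] [DecidableEq α] [AddCommGroup V] [Module ℂ V]
  {ρ : Representation ℂ (Equiv.Perm α) V}

theorem IsIrreducible.finrank_eq_one_of_eigenspace_eq_bot (h : ρ.IsIrreducible) {p q : α}
    (hpq : p ≠ q) {ε : ℂ} (hε : ε = 1 ∨ ε = -1)
    (hbot : Module.End.eigenspace (ρ (Equiv.swap p q)) ε = ⊥) : Module.finrank ℂ V = 1 := by
  have hcompl := isCompl_eigenspace_swap (ρ := ρ) p q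
  have htop : Module.End.eigenspace (ρ (Equiv.swap p q)) (-ε) = ⊤ := by
    rcases hε with rfl | rfl
    · rw [hbot] at hcompl
      exact eq_top_of_bot_isCompl hcompl
    · rw [hbot] at hcompl
      rw [neg_neg]
      exact eq_top_of_isCompl_bot hcompl
  refine h.finrank_eq_one_of_swap_eq_smul hpq (c := -ε) fun v => ?_
  rw [← Module.End.mem_eigenspace_iff, htop]
  exact Submodule.mem_top

theorem IsIrreducible.finrank_eq_one_of_finrank_eigenspace_eq_two [FiniteDimensional ℂ V]
    (h : ρ.IsIrreducible) (hα : 6 ≤ Fintype.card α) (p q : α)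
    (hdim : ∀ ε : ℂ, ε = 1 ∨ ε = -1 →
      Module.finrank ℂ (Module.End.eigenspace (ρ (Equiv.swap p q)) ε) = 2) :
    Module.finrank ℂ V = 1 := by
  have hcard : 4 ≤ ({p, q} : Finset α)ᶜ.card := by
    rw [Finset.card_compl]
    have := Finset.card_le_two (a := p) (b := q)
    omega
  obtain ⟨s, hs, hs4⟩ := Finset.exists_subset_card_eq hcard
  obtain ⟨a, b, c, d, hab, hac, had, hbc, hbd, hcd, rfl⟩ := Finset.card_eq_four.1 hs4
  have hmem : ∀ x ∈ ({a, b, c, d} : Finset α), x ≠ p ∧ x ≠ q := fun x hx => by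
    simpa using hs hx
  let a' : {x : α // x ≠ p ∧ x ≠ q} := ⟨a, hmem a (by simp)⟩
  let b' : {x : α // x ≠ p ∧ x ≠ q} := ⟨b, hmem b (by simp)⟩
  let c' : {x : α // x ≠ p ∧ x ≠ q} := ⟨c, hmem c (by simp)⟩
  let d' : {x : α // x ≠ p ∧ x ≠ q} := ⟨d, hmem d (by simp)⟩
  have hfix : ∀ ε : ℂ, ε = 1 ∨ ε = -1 →
      ∀ v ∈ Module.End.eigenspace (ρ (Equiv.swap p q)) ε,
        ρ (Equiv.swap a b * Equiv.swap c d) v = v := by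
    intro ε hε v hv
    have h1 := swap_mul_swap_eq_one_of_finrank_eq_two
      (ρ := (ρ.offPair p q).restrictTo _ (offPair_apply_mem_eigenspace p q ε)) (hdim ε hε)
      (a := a') (b := b') (c := c') (d := d')
      (by simpa [a', b'] using hab) (by simpa [a', c'] using hac) (by simpa [a', d'] using had)
      (by simpa [b', c'] using hbc) (by simpa [b', d'] using hbd) (by simpa [c', d'] using hcd)
    have h2 := congrArg Subtype.val (LinearMap.congr_fun h1 ⟨v, hv⟩)
    change ρ (Equiv.Perm.ofSubtype (Equiv.swap a' b' * Equiv.swap c' d')) v = v at h2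
    rwa [map_mul, Equiv.Perm.ofSubtype_swap_eq, Equiv.Perm.ofSubtype_swap_eq] at h2
  refine h.finrank_eq_one_of_swap_mul_swap_eq_one hα hab hac had hbc hbd hcd
    (LinearMap.ext fun v => ?_)
  have hv : v ∈ Module.End.eigenspace (ρ (Equiv.swap p q)) 1 ⊔
      Module.End.eigenspace (ρ (Equiv.swap p q)) (-1) := by
    rw [(isCompl_eigenspace_swap p q).sup_eq_top]
    exact Submodule.mem_top
  obtain ⟨x, hx, y, hy, rfl⟩ := Submodule.mem_sup.1 hv
  rw [map_add, hfix 1 (Or.inl rfl) x hx, hfix (-1) (Or.inr rfl) y hy, Module.End.one_apply]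

end Dichotomy

/-- The degree of an irreducible representation of the symmetric group of a set with `n ≥ 5`
elements is `1`, `n - 1` or at least `2 * (n - 3)`. -/
theorem IsIrreducible.finrank_eq_or_le {α V : Type} [Fintype α] [DecidableEq α] [AddCommGroup V]
    [Module ℂ V] [FiniteDimensional ℂ V] {ρ : Representation ℂ (Equiv.Perm α) V}
    (h : ρ.IsIrreducible) (hα : 5 ≤ Fintype.card α) :
    Module.finrank ℂ V = 1 ∨ Module.finrank ℂ V = Fintype.card α - 1 ∨
      2 * (Fintype.card α - 3) ≤ Module.finrank ℂ V := by
  induction hn : Fintype.card α using Nat.strong_induction_on generalizing α V with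
  | _ n ih =>
    subst hn
    obtain ⟨p, q, hpq⟩ := Fintype.exists_pair_of_one_lt_card (α := α) (by omega)
    have hcard : Fintype.card {x : α // x ≠ p ∧ x ≠ q} = Fintype.card α - 2 := by
      rw [Fintype.card_subtype, ← Finset.card_pair hpq, ← Finset.card_compl]
      congr 1
      ext x
      simp
    obtain ⟨B, hB, hB2⟩ : ∃ B, (Fintype.card α = 6 ∧ B = 2 ∨ B = Fintype.card α - 3) ∧
        ∀ (W : Type) [AddCommGroup W] [Module ℂ W] [FiniteDimensional ℂ W]
          (π : Representation ℂ (Equiv.Perm {x : α // x ≠ p ∧ x ≠ q}) W), π.IsIrreducible →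
          Module.finrank ℂ W = 1 ∨ B ≤ Module.finrank ℂ W := by
      refine ⟨if Fintype.card α = 6 then 2 else Fintype.card α - 3, ?_, ?_⟩
      · split_ifs with h6 <;> simp [h6]
      · intro W _ _ _ π hπ
        have hpos : 0 < Module.finrank ℂ W := by
          have := (π.isIrreducible_iff_forall.1 hπ).1
          exact Module.finrank_pos
        by_cases h7 : 7 ≤ Fintype.card α
        · have := ih _ (by omega) hπ (by omega) hcard
          rw [if_neg (by omega)]
          omega
        · split_ifs <;> omega
    by_cases h1 : Module.finrank ℂ V = 1
    · exact Or.inl h1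
    have hmain : ∀ ε : ℂ, ε = 1 ∨ ε = -1 →
        (Module.finrank ℂ V = Fintype.card α - 1 ∨
          2 * (Fintype.card α - 3) ≤ Module.finrank ℂ V) ∨
        B ≤ Module.finrank ℂ (Module.End.eigenspace (ρ (Equiv.swap p q)) ε) := by
      intro ε hε
      have : Nontrivial (Module.End.eigenspace (ρ (Equiv.swap p q)) ε) :=
        Submodule.nontrivial_iff_ne_bot.2 fun hbot =>
          h1 (h.finrank_eq_one_of_eigenspace_eq_bot hpq hε hbot)
      rcases hasSemiInvariant_or_le_finrank (by omega) hB2 ((ρ.offPair p q).restrictTo _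
        (offPair_apply_mem_eigenspace p q ε)) with hs | hs
      · exact Or.inl ((h.finrank_of_hasSemiInvariant hα hpq hε hs).resolve_left h1)
      · exact Or.inr hs
    right
    rcases hmain 1 (Or.inl rfl) with hp | hp
    · exact hp
    rcases hmain (-1) (Or.inr rfl) with hm | hm
    · exact hm
    have hadd := Submodule.finrank_add_eq_of_isCompl (isCompl_eigenspace_swap (ρ := ρ) p q)
    by_cases h4 : Fintype.card α = 6 ∧ Module.finrank ℂ V = 4
    · refine absurd (h.finrank_eq_one_of_finrank_eigenspace_eq_two (by omega) p q ?_) h1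
      rintro ε (rfl | rfl) <;> omega
    · omega

end Representation

theorem eq_or_le_of_mem_cd_perm {n d : ℕ} (hn : 5 ≤ n) (hd : d ∈ cd (Equiv.Perm (Fin n))) :
    d = 1 ∨ d = n - 1 ∨ 2 * (n - 3) ≤ d := by
  obtain ⟨V, _, _, _, ρ, hρ, rfl⟩ := exists_irreducible_of_mem_cd hd
  simpa using hρ.finrank_eq_or_le (by simpa using hn)

theorem stmt17 (m n : ℕ) (hm : 5 ≤ m) (hn : 5 ≤ n)
    (h : cd (alternatingGroup (Fin m)) ⊆ cd (Equiv.Perm (Fin n))) : m = n := by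
  have hdvd : ∀ x ∈ cd (alternatingGroup (Fin m)), x ∣ n.factorial := fun x hx => by
    simpa [Fintype.card_perm] using dvd_card_of_mem_cd (h hx)
  have h1 := sub_one_mem_cd_alternatingGroup (m := m) (by omega)
  have hd1 := hdvd _ h1
  have hd2 : 6 ≤ m → m * (m - 3) / 2 ∣ n.factorial := fun h6 =>
    hdvd _ (mul_sub_three_div_two_mem_cd_alternatingGroup h6)
  by_contra hne
  have hle : 2 * n - 5 ≤ m := by
    have := eq_or_le_of_mem_cd_perm hn (h h1)
    omega
  have hcount : ∀ m₀, 1 ≤ m₀ → 2 ^ (m₀ + 1) * n.factorial < m₀.factorial → m < m₀ := by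
    intro m₀ hm₀ hlt
    by_contra! hmm
    exact not_cd_subset_of_two_pow_mul_factorial_lt (by omega)
      (two_pow_mul_factorial_lt_of_le hmm hlt hm₀) h
  rcases le_or_gt 9 n with h9 | h9
  · have := hcount (2 * n - 5) (by omega) (two_pow_mul_factorial_lt_of_nine_le h9)
    omega
  interval_cases n
  · have := hcount 9 (by norm_num) (by decide)
    interval_cases m
    · exact hne rfl
    · exact absurd (hd2 (by norm_num)) (by decide)
    · exact absurd (hd2 (by norm_num)) (by decide)
    · exact absurd hd1 (by decide)
  · have := hcount 10 (by norm_num) (by decide)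
    interval_cases m
    · exact absurd (hd2 (by norm_num)) (by decide)
    · exact absurd hd1 (by decide)
    · exact absurd (hd2 (by norm_num)) (by decide)
  · have := hcount 11 (by norm_num) (by decide)
    interval_cases m
    · exact absurd (hd2 (by norm_num)) (by decide)
    · have hle := factorial_le_of_cd_subset (by norm_num) h
      have h42 : 4 * Fintype.card (Nat.Partition 10) * Nat.factorial 7 ≤
          4 * 42 * Nat.factorial 7 := by
        gcongr
        exact card_partition_ten_le
      exact absurd (hle.trans h42) (by decide)
  · have := hcount 12 (by norm_num) (by decide)
    interval_cases m
    exact absurd (hd2 (by norm_num)) (by decide)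
end
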